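/- arXiv:2205.08251 — 2 statements merged into one kernel-verified Lean document; each statement's English description precedes it below -/
import Mathlib

section
/- For every closed path polyomino P, the polyomino ideal I_P ⊆ S is a radical ideal. -/
namespace ClosedPathPaper

open MvPolynomial

/-- Lattice points of `ℤ²`; a cell is identified with its lower left corner. -/
abbrev Pt : Type := ℤ × ℤ

/-- The four vertices (corners) of the unit cell with lower left corner `a`. -/
def cellVerts (a : Pt) : Set Pt :=
  {a, (a.1 + 1, a.2), (a.1, a.2 + 1), (a.1 + 1, a.2 + 1)}

/-- The vertex set `V(P)` of a collection of cells `P`. -/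
def VP (P : Finset Pt) : Set Pt := ⋃ a ∈ P, cellVerts a

/-- `[a,b]` is a proper interval and every cell contained in it belongs to `P`. -/
def IsInnerInterval (P : Finset Pt) (a b : Pt) : Prop :=
  a.1 < b.1 ∧ a.2 < b.2 ∧
    ∀ c : Pt, a.1 ≤ c.1 → c.1 < b.1 → a.2 ≤ c.2 → c.2 < b.2 → c ∈ P

/-- The four corners of the proper interval `[a,b]`:
diagonal corners `a, b` and anti-diagonal corners `c = (a.1, b.2)`, `d = (b.1, a.2)`. -/
def cornersOf (a b : Pt) : Finset Pt := {a, b, (a.1, b.2), (b.1, a.2)}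

/-- The inner 2-minor `f_{a,b} = x_a x_b - x_c x_d` attached to the inner interval `[a,b]`. -/
noncomputable def innerMinor (K : Type*) [Field K] (a b : Pt) : MvPolynomial Pt K :=
  X a * X b - X (a.1, b.2) * X (b.1, a.2)

/-- The set `G` of all inner 2-minors of `P`. -/
def minorsSet (K : Type*) [Field K] (P : Finset Pt) : Set (MvPolynomial Pt K) :=
  {f | ∃ a b : Pt, IsInnerInterval P a b ∧ f = innerMinor K a b}

/-- The polyomino ideal `I_P`. -/
noncomputable def polyoIdeal (K : Type*) [Field K] (P : Finset Pt) :
    Ideal (MvPolynomial Pt K) :=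
  Ideal.span (minorsSet K P)

/-! ### Monomial orders -/

/-- Strict lexicographic comparison of exponent vectors induced by the
(strict total) order `po` on the variables. -/
def lexLt (po : Pt → Pt → Prop) (u v : Pt →₀ ℕ) : Prop :=
  ∃ w : Pt, u w < v w ∧ ∀ w' : Pt, po w w' → u w' = v w'

def lexLe (po : Pt → Pt → Prop) (u v : Pt →₀ ℕ) : Prop := u = v ∨ lexLt po u v

/-- `m` is the leading monomial of `f` with respect to the lexicographic order
induced by `po`. -/
def IsLM {K : Type*} [Field K] (po : Pt → Pt → Prop) (f : MvPolynomial Pt K)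
    (m : Pt →₀ ℕ) : Prop :=
  m ∈ f.support ∧ ∀ m' ∈ f.support, lexLe po m' m

/-- `sp` is the S-polynomial of `f` and `g` with respect to the lexicographic
order induced by `po`. -/
def IsSPoly {K : Type*} [Field K] (po : Pt → Pt → Prop) (f g sp : MvPolynomial Pt K) : Prop :=
  ∃ mf mg : Pt →₀ ℕ, IsLM po f mf ∧ IsLM po g mg ∧
    sp = monomial (mf ⊔ mg - mf) (f.coeff mf)⁻¹ * f
       - monomial (mf ⊔ mg - mg) (g.coeff mg)⁻¹ * g

/-- `h` has a standard expression with respect to `G`, i.e. `h` reduces to `0`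
modulo `G` with respect to the lexicographic order induced by `po`. -/
def ReducesToZero {K : Type*} [Field K] (po : Pt → Pt → Prop)
    (G : Set (MvPolynomial Pt K)) (h : MvPolynomial Pt K) : Prop :=
  ∃ (F : Finset (MvPolynomial Pt K)) (q : MvPolynomial Pt K → MvPolynomial Pt K),
    ↑F ⊆ G ∧ h = ∑ g ∈ F, q g * g ∧
    ∀ g ∈ F, ∀ m, IsLM po (q g * g) m → ∃ mh, IsLM po h mh ∧ lexLe po m mh

/-- The exponent vector of `x_u x_v x_w`. -/
noncomputable def mono3 (u v w : Pt) : Pt →₀ ℕ :=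
  Finsupp.single u 1 + Finsupp.single v 1 + Finsupp.single w 1

/-- The leading monomials, viewed as polynomials, of the members of `G`. -/
def leadingMonomials {K : Type*} [Field K] (po : Pt → Pt → Prop)
    (G : Set (MvPolynomial Pt K)) : Set (MvPolynomial Pt K) :=
  {f | ∃ g ∈ G, ∃ m, IsLM po g m ∧ f = monomial m (1 : K)}

/-- The initial ideal of `I` with respect to the lexicographic order induced by `po`. -/
noncomputable def initialIdeal {K : Type*} [Field K] (po : Pt → Pt → Prop)
    (I : Ideal (MvPolynomial Pt K)) : Ideal (MvPolynomial Pt K) :=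
  Ideal.span (leadingMonomials po (I : Set (MvPolynomial Pt K)))

/-- `G` is a Gröbner basis of `I`. -/
def IsGroebnerBasis {K : Type*} [Field K] (po : Pt → Pt → Prop)
    (G : Set (MvPolynomial Pt K)) (I : Ideal (MvPolynomial Pt K)) : Prop :=
  Ideal.span G = I ∧ Ideal.span (leadingMonomials po G) = initialIdeal po I

/-- `G` is the reduced Gröbner basis of `I` (up to normalizing signs). -/
def IsReducedGroebnerBasis {K : Type*} [Field K] (po : Pt → Pt → Prop)
    (G : Set (MvPolynomial Pt K)) (I : Ideal (MvPolynomial Pt K)) : Prop :=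
  IsGroebnerBasis po G I ∧
  (∀ g ∈ G, ∃ m, IsLM po g m ∧ (g.coeff m = 1 ∨ g.coeff m = -1)) ∧
  (∀ g ∈ G, ∀ g' ∈ G, g' ≠ g → ∀ m ∈ g.support, ∀ m', IsLM po g' m' → ¬ m' ≤ m)

/-! ### Closed paths and special configurations -/

/-- Two cells share a common edge. -/
def cellAdj (a b : Pt) : Prop :=
  b = (a.1 + 1, a.2) ∨ b = (a.1 - 1, a.2) ∨ b = (a.1, a.2 + 1) ∨ b = (a.1, a.2 - 1)

/-- `P` is a closed path polyomino. -/
def IsClosedPath (P : Finset Pt) : Prop :=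
  ∃ n : ℕ, 5 < n ∧ ∃ A : ZMod n → Pt,
    Function.Injective A ∧
    (∀ i, cellAdj (A i) (A (i + 1))) ∧
    (∀ i j : ZMod n, j ≠ i - 2 → j ≠ i - 1 → j ≠ i → j ≠ i + 1 → j ≠ i + 2 →
      cellVerts (A i) ∩ cellVerts (A j) = ∅) ∧
    ∀ c : Pt, c ∈ P ↔ ∃ i, A i = c

/-- The horizontal block of rank `m` whose leftmost cell is `a`. -/
def hBlockCells (a : Pt) (m : ℕ) : Finset Pt :=
  (Finset.range m).image fun t : ℕ => (a.1 + (t : ℤ), a.2)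

/-- The vertical block of rank `m` whose bottom cell is `a`. -/
def vBlockCells (a : Pt) (m : ℕ) : Finset Pt :=
  (Finset.range m).image fun t : ℕ => (a.1, a.2 + (t : ℤ))

/-- The vertex set of a finite set of cells. -/
def vertsOfCells (s : Finset Pt) : Set Pt := ⋃ c ∈ s, cellVerts c

/-- A W-pentomino of `P`: a horizontal block of rank two with leftmost cell `a₁`, a
vertical block of rank two with bottom cell `a₂`, and a middle cell `A` not belonging to the
two blocks, such that the vertex sets of the two blocks meet exactly in the lower right
corner of `A`. -/
def IsWPentomino (P : Finset Pt) (a₁ a₂ A : Pt) : Prop :=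
  hBlockCells a₁ 2 ⊆ P ∧ vBlockCells a₂ 2 ⊆ P ∧ A ∈ P ∧
  A ∉ hBlockCells a₁ 2 ∪ vBlockCells a₂ 2 ∧
  vertsOfCells (hBlockCells a₁ 2) ∩ vertsOfCells (vBlockCells a₂ 2) = {(A.1 + 1, A.2)}

/-- An RW-heptomino of `P`: a horizontal block of rank three with leftmost cell `a₁`, a
vertical block of rank three with bottom cell `a₂`, and a middle cell `A` not belonging to
the two blocks, such that the vertex sets of the two blocks meet exactly in the upper left
corner of `A`. -/
def IsRWHeptomino (P : Finset Pt) (a₁ a₂ A : Pt) : Prop :=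
  hBlockCells a₁ 3 ⊆ P ∧ vBlockCells a₂ 3 ⊆ P ∧ A ∈ P ∧
  A ∉ hBlockCells a₁ 3 ∪ vBlockCells a₂ 3 ∧
  vertsOfCells (hBlockCells a₁ 3) ∩ vertsOfCells (vBlockCells a₂ 3) = {(A.1, A.2 + 1)}

/-- An LD-horizontal skew tetromino of `P` (base point `p`): the cells
`p, p+(1,0), p+(1,1), p+(2,1)`. -/
def IsLDhTetromino (P : Finset Pt) (p : Pt) : Prop :=
  p ∈ P ∧ (p.1 + 1, p.2) ∈ P ∧ (p.1 + 1, p.2 + 1) ∈ P ∧ (p.1 + 2, p.2 + 1) ∈ P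

/-- An LD-vertical skew tetromino of `P` (base point `p`): the cells
`p, p+(0,1), p+(1,1), p+(1,2)`. -/
def IsLDvTetromino (P : Finset Pt) (p : Pt) : Prop :=
  p ∈ P ∧ (p.1, p.2 + 1) ∈ P ∧ (p.1 + 1, p.2 + 1) ∈ P ∧ (p.1 + 1, p.2 + 2) ∈ P

/-- An LD-horizontal skew hexomino of `P` (base point `p`): the cells
`p, p+(1,0), p+(2,0), p+(2,1), p+(3,1), p+(4,1)`. -/
def IsLDhHexomino (P : Finset Pt) (p : Pt) : Prop :=
  p ∈ P ∧ (p.1 + 1, p.2) ∈ P ∧ (p.1 + 2, p.2) ∈ P ∧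
  (p.1 + 2, p.2 + 1) ∈ P ∧ (p.1 + 3, p.2 + 1) ∈ P ∧ (p.1 + 4, p.2 + 1) ∈ P

/-- An LD-vertical skew hexomino of `P` (base point `p`): the cells
`p, p+(0,1), p+(0,2), p+(1,2), p+(1,3), p+(1,4)`. -/
def IsLDvHexomino (P : Finset Pt) (p : Pt) : Prop :=
  p ∈ P ∧ (p.1, p.2 + 1) ∈ P ∧ (p.1, p.2 + 2) ∈ P ∧
  (p.1 + 1, p.2 + 2) ∈ P ∧ (p.1 + 1, p.2 + 3) ∈ P ∧ (p.1 + 1, p.2 + 4) ∈ P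

/-- The total order `<¹` on `ℤ²`. -/
def lt1 (a b : Pt) : Prop := a.1 < b.1 ∨ (a.1 = b.1 ∧ a.2 < b.2)

/-- The P-order `<^Y` attached to a set `Y` of vertices. -/
def Ylt (Y : Set Pt) (a b : Pt) : Prop :=
  (a ∉ Y ∧ b ∈ Y) ∨ (a ∉ Y ∧ b ∉ Y ∧ lt1 a b) ∨ (a ∈ Y ∧ b ∈ Y ∧ lt1 a b)


set_option linter.all false

section Abs

variable {σ : Type*}

/-- The exponent vector of `x_x x_y`. -/
noncomputable def prs (x y : σ) : σ →₀ ℕ := Finsupp.single x 1 + Finsupp.single y 1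

/-- One undirected rewriting step on monomials. -/
def UStep (mv : σ → σ → σ → σ → Prop) (m m' : σ →₀ ℕ) : Prop :=
  ∃ (s : σ →₀ ℕ) (x y z t : σ), mv x y z t ∧ m = s + prs x y ∧ m' = s + prs z t

/-- One weight-decreasing rewriting step on monomials. -/
def DStep (mv : σ → σ → σ → σ → Prop) (W : σ → ℕ) (m m' : σ →₀ ℕ) : Prop :=
  UStep mv m m' ∧ Finsupp.weight W m' < Finsupp.weight W m

open Classical in
/-- A chosen normal form of a monomial. -/
noncomputable def nf (mv : σ → σ → σ → σ → Prop) (W : σ → ℕ) (m : σ →₀ ℕ) : σ →₀ ℕ :=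
  if h : ∃ m', DStep mv W m m' then nf mv W h.choose else m
termination_by Finsupp.weight W m
decreasing_by exact h.choose_spec.2

/-- The hypotheses on a rewriting system of quadratic binomials. -/
structure GoodSys (mv : σ → σ → σ → σ → Prop) (W : σ → ℕ) : Prop where
  swap : ∀ {x y z t}, mv x y z t → mv y x z t
  symm : ∀ {x y z t}, mv x y z t → mv z t x y
  ne : ∀ {x y z t}, mv x y z t → x ≠ y
  strict : ∀ {x y z t}, mv x y z t → W x + W y ≠ W z + W t
  uniq : ∀ {x y z t z' t'}, mv x y z t → mv x y z' t' → prs z t = prs z' t'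
  conf : ∀ {v y z t y' z' t'}, mv v y z t → mv v y' z' t' → y ≠ y' →
    W z + W t < W v + W y → W z' + W t' < W v + W y' →
    UStep mv (prs z t + Finsupp.single y' 1) (prs z' t' + Finsupp.single y 1) ∨
    ∃ c, UStep mv (prs z t + Finsupp.single y' 1) c ∧
      UStep mv c (prs z' t' + Finsupp.single y 1) ∧
      Finsupp.weight W c < W v + W y + W y'

variable {mv : σ → σ → σ → σ → Prop} {W : σ → ℕ}

lemma weight_prs (x y : σ) : Finsupp.weight W (prs x y) = W x + W y := by
  simp [prs, Finsupp.weight_single]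

lemma prs_comm (x y : σ) : prs x y = prs y x := add_comm _ _

lemma UStep.add {a b : σ →₀ ℕ} (h : UStep mv a b) (r : σ →₀ ℕ) : UStep mv (r + a) (r + b) := by
  obtain ⟨s, x, y, z, t, h1, rfl, rfl⟩ := h
  exact ⟨r + s, x, y, z, t, h1, by rw [add_assoc], by rw [add_assoc]⟩

lemma UStep.symm' (g : GoodSys mv W) {a b : σ →₀ ℕ} (h : UStep mv a b) : UStep mv b a := by
  obtain ⟨s, x, y, z, t, h1, rfl, rfl⟩ := h
  exact ⟨s, z, t, x, y, g.symm h1, rfl, rfl⟩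

lemma UStep.wne (g : GoodSys mv W) {a b : σ →₀ ℕ} (h : UStep mv a b) :
    Finsupp.weight W a ≠ Finsupp.weight W b := by
  obtain ⟨s, x, y, z, t, h1, rfl, rfl⟩ := h
  have := g.strict h1
  simp only [map_add, weight_prs]
  omega

lemma nf_irred {m : σ →₀ ℕ} (h : ¬ ∃ m', DStep mv W m m') : nf mv W m = m := by
  rw [nf, dif_neg h]

lemma prs_le_of_eq {s s' : σ →₀ ℕ} {x y x' y' : σ} (c1 : x ≠ x') (c2 : x ≠ y') (c3 : y ≠ x')
    (c4 : y ≠ y') (e : s + prs x y = s' + prs x' y') : prs x' y' ≤ s := by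
  classical
  intro a
  have := DFunLike.congr_fun e a
  simp only [prs, Finsupp.add_apply, Finsupp.single_apply] at this ⊢
  by_cases h1 : x = a
  · rw [if_neg (fun h => c1 (h1.trans h.symm)), if_neg (fun h => c2 (h1.trans h.symm))]
    omega
  by_cases h2 : y = a
  · rw [if_neg (fun h => c3 (h2.trans h.symm)), if_neg (fun h => c4 (h2.trans h.symm))]
    omega
  rw [if_neg h1, if_neg h2] at this
  omega

lemma nf_step (g : GoodSys mv W) : ∀ (k : ℕ) (m m' : σ →₀ ℕ), Finsupp.weight W m = k →
    DStep mv W m m' → nf mv W m = nf mv W m' := by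
  intro k
  induction k using Nat.strong_induction_on with
  | _ k ih =>
  -- undirected steps below `k`
  have ihU : ∀ a b, UStep mv a b → Finsupp.weight W a < k → Finsupp.weight W b < k →
      nf mv W a = nf mv W b := by
    intro a b hab ha hb
    rcases lt_or_gt_of_ne (hab.wne g) with h | h
    · exact (ih _ hb b a rfl ⟨hab.symm' g, h⟩).symm
    · exact ih _ ha a b rfl ⟨hab, h⟩
  -- shared first variable
  have share : ∀ (s s' : σ →₀ ℕ) (v y z t y' z' t' : σ), mv v y z t → mv v y' z' t' →
      s + prs v y = s' + prs v y' → Finsupp.weight W (s + prs v y) = k →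
      Finsupp.weight W (s + prs z t) < k → Finsupp.weight W (s' + prs z' t') < k →
      nf mv W (s + prs z t) = nf mv W (s' + prs z' t') := by
    intro s s' v y z t y' z' t' h h' e hk h1 h2
    by_cases hy : y = y'
    · subst hy
      have : s = s' := by simpa using e
      subst this
      rw [g.uniq h h']
    · have e2 : s + Finsupp.single y 1 = s' + Finsupp.single y' 1 := by
        have : (s + Finsupp.single y 1) + Finsupp.single v 1
          = (s' + Finsupp.single y' 1) + Finsupp.single v 1 := by
          unfold prs at e
          rw [add_assoc, add_assoc, add_comm (Finsupp.single y 1), add_comm (Finsupp.single y' 1)]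
          exact e
        exact add_right_cancel this
      have hle : Finsupp.single y' 1 ≤ s := by
        classical
        intro a
        have := DFunLike.congr_fun e2 a
        simp only [Finsupp.add_apply, Finsupp.single_apply] at this ⊢
        split_ifs at this ⊢ <;> first | omega | (subst_vars; exact absurd rfl hy)
      obtain ⟨r, rfl⟩ : ∃ r, s = r + Finsupp.single y' 1 :=
        ⟨s - Finsupp.single y' 1, (tsub_add_cancel_of_le hle).symm⟩
      have e3 : s' = r + Finsupp.single y 1 := by
        have : s' + Finsupp.single y' 1 = (r + Finsupp.single y 1) + Finsupp.single y' 1 := by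
          rw [← e2]; abel
        exact add_right_cancel this
      subst e3
      simp only [map_add, weight_prs, Finsupp.weight_single, one_smul] at hk h1 h2
      have E1 : r + Finsupp.single y' 1 + prs z t = r + (prs z t + Finsupp.single y' 1) := by abel
      have E2 : r + Finsupp.single y 1 + prs z' t' = r + (prs z' t' + Finsupp.single y 1) := by abel
      rw [E1, E2]
      rcases g.conf h h' hy (by omega) (by omega) with hc | ⟨c, hc1, hc2, hc3⟩
      · apply ihU _ _ (hc.add r) <;>
          simp only [map_add, weight_prs, Finsupp.weight_single, one_smul] <;> omega
      · rw [ihU _ _ (hc1.add r), ihU _ _ (hc2.add r)] <;>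
          simp only [map_add, weight_prs, Finsupp.weight_single, one_smul] <;> omega
  have conn : ∀ m m1 m2, Finsupp.weight W m = k → DStep mv W m m1 → DStep mv W m m2 →
      nf mv W m1 = nf mv W m2 := by
    rintro m m1 m2 hk ⟨⟨s, x, y, z, t, h, rfl, rfl⟩, h1⟩ ⟨⟨s', x', y', z', t', h', e, rfl⟩, h2⟩
    rw [hk] at h1 h2
    by_cases c1 : x = x'
    · subst c1; exact share _ _ _ _ _ _ _ _ _ h h' e hk h1 h2
    by_cases c2 : x = y'
    · subst c2; rw [prs_comm x' x] at e
      exact share _ _ _ _ _ _ _ _ _ h (g.swap h') e hk h1 h2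
    rw [prs_comm x y] at e hk
    by_cases c3 : y = x'
    · subst c3; exact share _ _ _ _ _ _ _ _ _ (g.swap h) h' e hk h1 h2
    by_cases c4 : y = y'
    · subst c4; rw [prs_comm x' y] at e
      exact share _ _ _ _ _ _ _ _ _ (g.swap h) (g.swap h') e hk h1 h2
    rw [prs_comm y x] at e hk
    have hle : prs x' y' ≤ s := prs_le_of_eq c1 c2 c3 c4 e
    obtain ⟨r, rfl⟩ : ∃ r, s = r + prs x' y' := ⟨s - prs x' y', (tsub_add_cancel_of_le hle).symm⟩
    have e3 : s' = r + prs x y := by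
      have : s' + prs x' y' = (r + prs x y) + prs x' y' := by rw [← e]; abel
      exact add_right_cancel this
    subst e3
    simp only [map_add, weight_prs] at hk h1 h2
    have k1 : nf mv W (r + prs x' y' + prs z t) = nf mv W (r + prs z t + prs z' t') := by
      apply ihU
      · exact ⟨r + prs z t, x', y', z', t', h', by abel, rfl⟩
      all_goals simp only [map_add, weight_prs]; omega
    have k2 : nf mv W (r + prs x y + prs z' t') = nf mv W (r + prs z t + prs z' t') := by
      apply ihU
      · exact ⟨r + prs z' t', x, y, z, t, h, by abel, by abel⟩
      all_goals simp only [map_add, weight_prs]; omega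
    rw [k1, k2]
  intro m m' hk hd
  have hex : ∃ m', DStep mv W m m' := ⟨m', hd⟩
  rw [nf, dif_pos hex]
  exact conn m _ _ hk hex.choose_spec hd

lemma nf_ustep (g : GoodSys mv W) {a b : σ →₀ ℕ} (h : UStep mv a b) : nf mv W a = nf mv W b := by
  rcases lt_or_gt_of_ne (h.wne g) with h' | h'
  · exact (nf_step g _ b a rfl ⟨h.symm' g, h'⟩).symm
  · exact nf_step g _ a b rfl ⟨h, h'⟩

variable (K : Type*) [Field K]

/-- The ideal of a rewriting system. -/
noncomputable def sysIdeal (mv : σ → σ → σ → σ → Prop) : Ideal (MvPolynomial σ K) :=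
  Ideal.span {f | ∃ x y z t, mv x y z t ∧ f = X x * X y - X z * X t}

/-- The linear normal form map. -/
noncomputable def NF (mv : σ → σ → σ → σ → Prop) (W : σ → ℕ) :
    MvPolynomial σ K →ₗ[K] MvPolynomial σ K :=
  (basisMonomials σ K).constr K (fun m => monomial (nf mv W m) (1 : K))

lemma NF_monomial (m : σ →₀ ℕ) (c : K) :
    NF K mv W (monomial m c) = monomial (nf mv W m) c := by
  have : monomial m c = c • (basisMonomials σ K m) := by
    simp [coe_basisMonomials, smul_monomial]
  rw [this, map_smul, NF, Module.Basis.constr_basis, smul_monomial, smul_eq_mul, mul_one]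

lemma X_mul_X (x y : σ) : (X x * X y : MvPolynomial σ K) = monomial (prs x y) 1 := by
  simp [X, monomial_mul, prs]

lemma nf_props (m : σ →₀ ℕ) :
    (monomial m (1 : K) - monomial (nf mv W m) 1 ∈ sysIdeal K mv) ∧
    (¬ ∃ m', DStep mv W (nf mv W m) m') ∧
    (nf mv W m = m ∨ Finsupp.weight W (nf mv W m) < Finsupp.weight W m) := by
  by_cases h : ∃ m', DStep mv W m m'
  · have hs := h.choose_spec
    have e : nf mv W m = nf mv W h.choose := by rw [nf, dif_pos h]
    obtain ⟨i1, i2, i3⟩ := nf_props h.choose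
    rw [e]
    refine ⟨?_, i2, Or.inr ?_⟩
    · have : (monomial m (1 : K) - monomial h.choose 1) ∈ sysIdeal K mv := by
        obtain ⟨⟨s, x, y, z, t, h1, e1, e2⟩, -⟩ := hs
        have : (monomial m (1 : K) - monomial h.choose 1)
            = monomial s 1 * (X x * X y - X z * X t) := by
          rw [e2, X_mul_X, X_mul_X, mul_sub, monomial_mul, monomial_mul, mul_one, ← e1]
        rw [this]
        exact Ideal.mul_mem_left _ _ (Ideal.subset_span ⟨x, y, z, t, h1, rfl⟩)
      simpa using Ideal.add_mem _ this i1
    · have := hs.2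
      rcases i3 with i3 | i3
      · rw [i3]; exact this
      · omega
  · rw [nf_irred h]
    exact ⟨by simp, h, Or.inl rfl⟩
termination_by Finsupp.weight W m
decreasing_by exact hs.2

lemma NF_mem (g : GoodSys mv W) (f : MvPolynomial σ K) (hf : f ∈ sysIdeal K mv) :
    NF K mv W f = 0 := by
  suffices H : ∀ a, NF K mv W (a * f) = 0 by simpa using H 1
  unfold sysIdeal at hf
  induction hf using Submodule.span_induction with
  | zero => simp
  | add a b _ _ ha hb => intro c; rw [mul_add, map_add, ha, hb, add_zero]
  | mem f hf =>
    obtain ⟨x, y, z, t, h, rfl⟩ := hf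
    intro a
    induction a using MvPolynomial.induction_on' with
    | monomial s c =>
      rw [X_mul_X, X_mul_X, mul_sub, monomial_mul, monomial_mul, map_sub, NF_monomial,
        NF_monomial, sub_eq_zero, nf_ustep g ⟨s, x, y, z, t, h, rfl, rfl⟩]
    | add p q hp hq => rw [add_mul, map_add, hp, hq, add_zero]
  | smul b f hf ih =>
    intro a
    rw [smul_eq_mul, ← mul_assoc]
    exact ih _

lemma sub_NF_mem (f : MvPolynomial σ K) : f - NF K mv W f ∈ sysIdeal K mv := by
  induction f using MvPolynomial.induction_on' with
  | monomial s c =>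
    rw [NF_monomial]
    have := Ideal.mul_mem_left _ (C c) (nf_props (mv := mv) (W := W) K s).1
    simpa [mul_sub, C_mul_monomial] using this
  | add p q hp hq =>
    rw [map_add, add_sub_add_comm]
    exact Ideal.add_mem _ hp hq

lemma NF_support (f : MvPolynomial σ K) :
    ∀ m ∈ (NF K mv W f).support, ¬ ∃ m', DStep mv W m m' := by
  classical
  induction f using MvPolynomial.induction_on' with
  | monomial s c =>
    intro m hm
    rw [NF_monomial] at hm
    have := support_monomial_subset hm
    rw [Finset.mem_singleton] at this
    rw [this]
    exact (nf_props (mv := mv) (W := W) K s).2.1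
  | add p q hp hq =>
    intro m hm
    rw [map_add] at hm
    rcases Finset.mem_union.1 (support_add hm) with h | h
    · exact hp m h
    · exact hq m h

lemma irred_double (g : GoodSys mv W) {a : σ →₀ ℕ} (h : ¬ ∃ m', DStep mv W a m') :
    ¬ ∃ m', DStep mv W (a + a) m' := by
  classical
  rintro ⟨m', ⟨s, x, y, z, t, h1, e, rfl⟩, hw⟩
  apply h
  have hle : prs x y ≤ a := by
    intro b
    have := DFunLike.congr_fun e b
    have hne := g.ne h1
    simp only [prs, Finsupp.add_apply, Finsupp.single_apply] at this ⊢
    split_ifs at this ⊢ <;> first | omega | (subst_vars; simp_all)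
  refine ⟨(a - prs x y) + prs z t,
    ⟨_, x, y, z, t, h1, (tsub_add_cancel_of_le hle).symm, rfl⟩, ?_⟩
  rw [e] at hw
  conv_rhs => rw [← tsub_add_cancel_of_le hle]
  simp only [map_add, weight_prs] at hw ⊢
  omega

theorem sys_radical (g : GoodSys mv W) : (sysIdeal K mv).IsRadical := by
  classical
  rw [Ideal.isRadical_iff_pow_one_lt 2 (by norm_num)]
  intro f hf
  set p := NF K mv W f with hp
  have hfp : f - p ∈ sysIdeal K mv := sub_NF_mem K f
  suffices hp0 : p = 0 by simpa [hp0] using hfp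
  have hpp : p * p ∈ sysIdeal K mv := by
    have : p * p = f ^ 2 - (f + p) * (f - p) := by ring
    rw [this]
    exact Ideal.sub_mem _ hf (Ideal.mul_mem_left _ _ hfp)
  have hN := NF_mem K g _ hpp
  by_contra hne
  have hsupp : p.support.Nonempty := by
    rwa [Finset.nonempty_iff_ne_empty, Ne, MvPolynomial.support_eq_empty]
  obtain ⟨b, hb, hmax⟩ := Finset.exists_max_image p.support (Finsupp.weight W) hsupp
  set S := p.support.filter (fun m => Finsupp.weight W m = Finsupp.weight W b) with hS
  have hSn : S.Nonempty := ⟨b, by simp only [hS, Finset.mem_filter, hb, and_self]⟩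
  obtain ⟨a, ha, a', ha', hu⟩ := UniqueSums.uniqueAdd_of_nonempty hSn hSn
  have haa : a = a' := (hu ha' ha (add_comm _ _)).2
  subst haa
  have ha1 := Finset.mem_filter.1 ha
  have hexp : p * p = ∑ m ∈ p.support, ∑ m' ∈ p.support,
      monomial (m + m') (p.coeff m * p.coeff m') := by
    conv_lhs => rw [p.as_sum, Finset.sum_mul_sum]
    simp only [monomial_mul]
  have hirr : nf mv W (a + a) = a + a :=
    nf_irred (irred_double g (NF_support K f a ha1.1))
  have hkey : ∀ m ∈ p.support, ∀ m' ∈ p.support, nf mv W (m + m') = a + a → m = a ∧ m' = a := by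
    intro m hm m' hm' e
    have h1 := hmax m hm
    have h2 := hmax m' hm'
    have h3 := (nf_props (mv := mv) (W := W) K (m + m')).2.2
    rw [e] at h3
    simp only [map_add] at h3
    have h4 : Finsupp.weight W m = Finsupp.weight W b ∧ Finsupp.weight W m' = Finsupp.weight W b := by
      rcases h3 with h3 | h3
      · have := congrArg (Finsupp.weight W) h3
        simp only [map_add] at this
        omega
      · omega
    have h5 : a + a = m + m' := by
      rcases h3 with h3 | h3
      · exact h3
      · omega
    exact hu (Finset.mem_filter.2 ⟨hm, h4.1⟩) (Finset.mem_filter.2 ⟨hm', h4.2⟩) h5.symm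
  have hco : coeff (a + a) (NF K mv W (p * p)) = p.coeff a * p.coeff a := by
    rw [hexp]
    simp only [map_sum, NF_monomial, coeff_sum, coeff_monomial]
    rw [Finset.sum_eq_single a, Finset.sum_eq_single a]
    · rw [hirr, if_pos rfl]
    · intro m hm hma
      rw [if_neg]
      exact fun e => hma (hkey _ ha1.1 _ hm e).2
    · intro h; exact absurd ha1.1 h
    · intro m hm hma
      apply Finset.sum_eq_zero
      intro m' hm'
      rw [if_neg]
      exact fun e => hma (hkey _ hm _ hm' e).1
    · intro h; exact absurd ha1.1 h
  rw [hN, coeff_zero] at hco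
  have := mem_support_iff.1 ha1.1
  exact this (mul_self_eq_zero.1 hco.symm)

end Abs

section Path

/-- The lattice point `v` is a vertex of the cell `a`. -/
def On (v a : Pt) : Prop := a.1 ≤ v.1 ∧ v.1 ≤ a.1 + 1 ∧ a.2 ≤ v.2 ∧ v.2 ≤ a.2 + 1

lemma mem_cellVerts_of_On {v a : Pt} (h : On v a) : v ∈ cellVerts a := by
  obtain ⟨h1, h2, h3, h4⟩ := h
  simp only [cellVerts, Set.mem_insert_iff, Set.mem_singleton_iff, Prod.ext_iff]
  omega

/-- The data of a closed path. -/
structure CPath (n : ℕ) (A : ZMod n → Pt) : Prop where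
  hn : 5 < n
  inj : Function.Injective A
  adj : ∀ i, cellAdj (A i) (A (i + 1))
  disj : ∀ i j : ZMod n, j ≠ i - 2 → j ≠ i - 1 → j ≠ i → j ≠ i + 1 → j ≠ i + 2 →
      cellVerts (A i) ∩ cellVerts (A j) = ∅

/-- Unit vectors. -/
def IsU (u : Pt) : Prop := u = (1, 0) ∨ u = (-1, 0) ∨ u = (0, 1) ∨ u = (0, -1)

/-- Perpendicular unit vectors. -/
def Perp (u w : Pt) : Prop :=
  (u = (1, 0) ∨ u = (-1, 0)) ∧ (w = (0, 1) ∨ w = (0, -1)) ∨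
  (u = (0, 1) ∨ u = (0, -1)) ∧ (w = (1, 0) ∨ w = (-1, 0))

variable {n : ℕ} {A : ZMod n → Pt}

/-- The step from a cell to the next one. -/
def D (A : ZMod n → Pt) (i : ZMod n) : Pt := A (i + 1) - A i

lemma A_succ (A : ZMod n → Pt) (i : ZMod n) : A (i + 1) = A i + D A i := by simp [D]
lemma A_pred (A : ZMod n → Pt) (i : ZMod n) : A (i - 1) = A i - D A (i - 1) := by simp [D]
lemma A_succ2 (A : ZMod n → Pt) (i : ZMod n) : A (i + 2) = A i + D A i + D A (i + 1) := by
  have : i + 2 = i + 1 + 1 := by ring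
  rw [this, A_succ A, A_succ A]
lemma A_pred2 (A : ZMod n → Pt) (i : ZMod n) : A (i - 2) = A i - D A (i - 1) - D A (i - 2) := by
  have e : i - 2 = i - 1 - 1 := by ring
  rw [e, A_pred A (i - 1), A_pred A i]

namespace CPath

variable (c : CPath n A)
include c

lemma isU (i : ZMod n) : IsU (D A i) := by
  have := c.adj i
  rw [A_succ A] at this
  simp only [cellAdj, Prod.ext_iff, Prod.fst_add, Prod.snd_add] at this
  simp only [IsU, Prod.ext_iff]
  omega

lemma natne {k : ℕ} (h0 : 0 < k) (h5 : k ≤ 5) : (k : ZMod n) ≠ 0 := by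
  intro h
  rw [ZMod.natCast_eq_zero_iff] at h
  have := Nat.le_of_dvd h0 h
  have := c.hn
  omega

lemma ne1 : (1 : ZMod n) ≠ 0 := by simpa using c.natne (k := 1) (by norm_num) (by norm_num)
lemma ne2 : (2 : ZMod n) ≠ 0 := by simpa using c.natne (k := 2) (by norm_num) (by norm_num)
lemma ne3 : (3 : ZMod n) ≠ 0 := by simpa using c.natne (k := 3) (by norm_num) (by norm_num)
lemma ne4 : (4 : ZMod n) ≠ 0 := by simpa using c.natne (k := 4) (by norm_num) (by norm_num)
lemma ne5 : (5 : ZMod n) ≠ 0 := by simpa using c.natne (k := 5) (by norm_num) (by norm_num)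

lemma near {i j : ZMod n} {v : Pt} (h1 : On v (A i)) (h2 : On v (A j)) :
    j = i - 2 ∨ j = i - 1 ∨ j = i ∨ j = i + 1 ∨ j = i + 2 := by
  by_contra h
  push Not at h
  have := c.disj i j h.1 h.2.1 h.2.2.1 h.2.2.2.1 h.2.2.2.2
  have hv : v ∈ cellVerts (A i) ∩ cellVerts (A j) :=
    ⟨mem_cellVerts_of_On h1, mem_cellVerts_of_On h2⟩
  rw [this] at hv
  exact hv

lemma far3 {i : ZMod n} {v : Pt} (h1 : On v (A i)) (h2 : On v (A (i + 3))) : False := by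
  rcases c.near h1 h2 with h | h | h | h | h
  · exact c.ne5 (by linear_combination h)
  · exact c.ne4 (by linear_combination h)
  · exact c.ne3 (by linear_combination h)
  · exact c.ne2 (by linear_combination h)
  · exact c.ne1 (by linear_combination h)

lemma noback (i : ZMod n) : D A (i + 1) ≠ - D A i := by
  intro h
  have h2 := A_succ2 A i
  rw [h, add_neg_cancel_right] at h2
  exact c.ne2 (by linear_combination c.inj h2)

lemma noback' (i : ZMod n) : D A i ≠ - D A (i - 1) := by
  have := c.noback (i - 1)
  rwa [sub_add_cancel] at this

lemma perp {i : ZMod n} (h : D A i ≠ D A (i - 1)) : Perp (D A (i - 1)) (D A i) := by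
  have h1 := c.isU i
  have h2 := c.isU (i - 1)
  have h3 := c.noback' i
  revert h1 h2 h3 h
  generalize D A i = w
  generalize D A (i - 1) = u
  rintro h1 (rfl | rfl | rfl | rfl) (rfl | rfl | rfl | rfl) h3 <;> simp_all [Perp]

/-- adjacent cells are consecutive -/
lemma adjIdx {j k : ZMod n} {u : Pt} (hu : IsU u) (h : A j = A k + u) : j = k - 1 ∨ j = k + 1 := by
  have h1 : ∃ v, On v (A k) ∧ On v (A j) := by
    rw [h]
    refine ⟨(max (A k).1 ((A k).1 + u.1), max (A k).2 ((A k).2 + u.2)), ?_⟩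
    rcases hu with rfl | rfl | rfl | rfl <;> simp [On]
  obtain ⟨v, hv1, hv2⟩ := h1
  have hu1 := c.isU k
  have hu2 := c.isU (k + 1)
  have hu3 := c.isU (k - 1)
  have hu4 := c.isU (k - 2)
  have key : ∀ x y : Pt, IsU x → IsU y → x + y ≠ u := by
    rintro x y (rfl | rfl | rfl | rfl) (rfl | rfl | rfl | rfl) <;>
      rcases hu with rfl | rfl | rfl | rfl <;> simp [Prod.ext_iff]
  have key' : ∀ x y : Pt, IsU x → IsU y → - x - y ≠ u := by
    rintro x y (rfl | rfl | rfl | rfl) (rfl | rfl | rfl | rfl) <;>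
      rcases hu with rfl | rfl | rfl | rfl <;> simp [Prod.ext_iff]
  rcases c.near hv1 hv2 with e | e | e | e | e
  · rw [e, A_pred2 A] at h
    refine absurd ?_ (key' _ _ hu3 hu4)
    linear_combination h
  · exact Or.inl e
  · rw [e] at h
    have : u = 0 := by linear_combination -h
    rcases hu with rfl | rfl | rfl | rfl <;> simp at this
  · exact Or.inr e
  · rw [e, A_succ2 A] at h
    refine absurd ?_ (key _ _ hu1 hu2)
    linear_combination h

end CPath

/-- Corner of the cell `a` in the diagonal direction `p`. -/
def cv (a p : Pt) : Pt := (a.1 + (1 + p.1) / 2, a.2 + (1 + p.2) / 2)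

/-- Special corners. -/
def sp (A : ZMod n → Pt) (i : ZMod n) : Prop :=
  D A i ≠ D A (i - 1) ∧ D A (i + 1) = D A (i - 1)

/-- Size of the inner mark. -/
def Sz (M : ℤ) (u v : Pt) : ℤ := M + (u.1 * v.1 + u.2 * v.2)

open Classical in
/-- The mark given to `v` by the cell of index `i`. -/
noncomputable def mrk (A : ZMod n → Pt) (M T : ℤ) (i : ZMod n) (v : Pt) : ℤ :=
  if sp A i then
    (if v = cv (A i) (D A i - D A (i - 1)) then - Sz M (D A (i - 1)) v else 0) +
    (if v = cv (A i) (D A (i - 1) - D A i) then T else 0)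
  else 0

/-- Total mark. -/
noncomputable def mu (A : ZMod n → Pt) [NeZero n] (M T : ℤ) (v : Pt) : ℤ := ∑ i, mrk A M T i v

lemma Perp.on_cv {u w : Pt} (h : Perp u w) (a : Pt) : On (cv a (w - u)) a ∧ On (cv a (u - w)) a ∧
    On (cv a (u + w)) a ∧ On (cv a (-u - w)) a := by
  rcases h with ⟨rfl | rfl, rfl | rfl⟩ | ⟨rfl | rfl, rfl | rfl⟩ <;> simp [On, cv]

namespace CPath
variable (c : CPath n A)
include c

lemma mrk_cases {M T : ℤ} {i : ZMod n} {v : Pt} (h : mrk A M T i v ≠ 0) :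
    sp A i ∧ (v = cv (A i) (D A i - D A (i - 1)) ∨ v = cv (A i) (D A (i - 1) - D A i)) := by
  unfold mrk at h
  by_cases h1 : sp A i
  · refine ⟨h1, ?_⟩
    by_contra h2
    push Not at h2
    rw [if_pos h1, if_neg h2.1, if_neg h2.2] at h
    simp at h
  · rw [if_neg h1] at h; exact absurd rfl h

lemma mrk_off {M T : ℤ} {i : ZMod n} {v : Pt} (h : ¬ On v (A i)) : mrk A M T i v = 0 := by
  by_contra h1
  obtain ⟨h2, h3⟩ := c.mrk_cases h1
  have h4 := (c.perp h2.1).on_cv (A i)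
  rcases h3 with rfl | rfl
  · exact h h4.1
  · exact h h4.2.1

lemma inn_on {i : ZMod n} (h : Perp (D A (i - 1)) (D A i)) :
    On (cv (A i) (D A i - D A (i - 1))) (A (i + 1)) ∧
    On (cv (A i) (D A i - D A (i - 1))) (A (i - 1)) := by
  rw [A_succ A, A_pred A]
  revert h
  generalize D A i = w
  generalize D A (i - 1) = u
  rintro (⟨rfl | rfl, rfl | rfl⟩ | ⟨rfl | rfl, rfl | rfl⟩) <;> simp [On, cv] 

lemma out_only {i k : ZMod n} (h : Perp (D A (i - 1)) (D A i)) (hs : D A (i + 1) = D A (i - 1))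
    (hk : On (cv (A i) (D A (i - 1) - D A i)) (A k)) : k = i := by
  rcases c.near (h.on_cv (A i)).2.1 hk with e | e | e | e | e
  · rw [e, A_pred2 A] at hk
    have h3 := c.noback (i - 2)
    have : i - 2 + 1 = i - 1 := by ring
    rw [this] at h3
    have h4 := c.isU (i - 2)
    clear hs
    revert h hk h3 h4
    generalize D A i = w
    generalize D A (i - 1) = u
    generalize D A (i - 2) = x
    rintro (⟨rfl | rfl, rfl | rfl⟩ | ⟨rfl | rfl, rfl | rfl⟩) hk h3 (rfl | rfl | rfl | rfl) <;>
      simp [On, cv] at hk h3 <;> omega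
  · rw [e, A_pred A] at hk
    clear hs
    revert h hk
    generalize D A i = w
    generalize D A (i - 1) = u
    rintro (⟨rfl | rfl, rfl | rfl⟩ | ⟨rfl | rfl, rfl | rfl⟩) hk <;>
      simp [On, cv] at hk
  · exact e
  · rw [e, A_succ A] at hk
    clear hs
    revert h hk
    generalize D A i = w
    generalize D A (i - 1) = u
    rintro (⟨rfl | rfl, rfl | rfl⟩ | ⟨rfl | rfl, rfl | rfl⟩) hk <;>
      simp [On, cv] at hk
  · rw [e, A_succ2 A, hs] at hk
    clear hs
    revert h hk
    generalize D A i = w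
    generalize D A (i - 1) = u
    rintro (⟨rfl | rfl, rfl | rfl⟩ | ⟨rfl | rfl, rfl | rfl⟩) hk <;>
      simp [On, cv] at hk <;> omega

lemma mu_local [NeZero n] {M T : ℤ} {k : ZMod n} {v : Pt} (h : On v (A k)) :
    mu A M T v = mrk A M T (k - 1) v + mrk A M T k v + mrk A M T (k + 1) v := by
  classical
  have h1 : ∑ i ∈ ({k - 1, k, k + 1} : Finset (ZMod n)), mrk A M T i v = mu A M T v := by
    apply Finset.sum_subset (Finset.subset_univ _)
    intro j _ hj
    simp only [Finset.mem_insert, Finset.mem_singleton, not_or] at hj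
    by_contra hne
    obtain ⟨h2, h3⟩ := c.mrk_cases hne
    have hp := c.perp h2.1
    rcases h3 with rfl | rfl
    · have hi := c.inn_on hp
      rcases c.near h (hp.on_cv (A j)).1 with e | e | e | e | e
      · refine c.far3 (i := j - 1) hi.2 ?_
        have : j - 1 + 3 = k := by rw [e]; ring
        rwa [this]
      · exact hj.1 e
      · exact hj.2.1 e
      · exact hj.2.2 e
      · refine c.far3 (i := k) h ?_
        have : k + 3 = j + 1 := by rw [e]; ring
        rw [this]; exact hi.1
    · exact hj.2.1 (c.out_only hp h2.2 h).symm
  rw [← h1, Finset.sum_insert, Finset.sum_insert, Finset.sum_singleton, add_assoc]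
  · simp only [Finset.mem_singleton]
    intro e; exact c.ne1 (by linear_combination -e)
  · simp only [Finset.mem_insert, Finset.mem_singleton, not_or]
    exact ⟨fun e => c.ne1 (by linear_combination -e), fun e => c.ne2 (by linear_combination -e)⟩

end CPath



lemma mrk_inner {M T : ℤ} {i : ZMod n} {v : Pt} (hs : sp A i) (hp : Perp (D A (i - 1)) (D A i))
    (hv : v = cv (A i) (D A i - D A (i - 1))) : mrk A M T i v = - Sz M (D A (i - 1)) v := by
  have : v ≠ cv (A i) (D A (i - 1) - D A i) := by
    rw [hv]
    revert hp
    generalize D A i = w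
    generalize D A (i - 1) = u
    rintro (⟨rfl | rfl, rfl | rfl⟩ | ⟨rfl | rfl, rfl | rfl⟩) <;> simp [cv, Prod.ext_iff]
  unfold mrk
  rw [if_pos hs, if_pos hv, if_neg this, add_zero]

lemma mrk_outer {M T : ℤ} {i : ZMod n} {v : Pt} (hs : sp A i) (hp : Perp (D A (i - 1)) (D A i))
    (hv : v = cv (A i) (D A (i - 1) - D A i)) : mrk A M T i v = T := by
  have : v ≠ cv (A i) (D A i - D A (i - 1)) := by
    rw [hv]
    revert hp
    generalize D A i = w
    generalize D A (i - 1) = u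
    rintro (⟨rfl | rfl, rfl | rfl⟩ | ⟨rfl | rfl, rfl | rfl⟩) <;> simp [cv, Prod.ext_iff]
  unfold mrk
  rw [if_pos hs, if_pos hv, if_neg this, zero_add]

lemma mrk_nsp {M T : ℤ} {i : ZMod n} {v : Pt} (hs : ¬ sp A i) : mrk A M T i v = 0 := by
  unfold mrk; rw [if_neg hs]

lemma mrk_zero {M T : ℤ} {i : ZMod n} {v : Pt}
    (h : sp A i → v ≠ cv (A i) (D A i - D A (i - 1)) ∧ v ≠ cv (A i) (D A (i - 1) - D A i)) :
    mrk A M T i v = 0 := by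
  by_cases hs : sp A i
  · unfold mrk; rw [if_pos hs, if_neg (h hs).1, if_neg (h hs).2, add_zero]
  · exact mrk_nsp hs

namespace CPath
variable (c : CPath n A)
include c

lemma mu_a1 [NeZero n] {M T : ℤ} {k : ZMod n} {u w : Pt} (hu : D A (k - 1) = u) (hw : D A k = w)
    (hp : Perp u w) :
    (D A (k + 1) = u → mu A M T (cv (A k) (u - w)) = T) ∧
    (D A (k + 1) ≠ u → mu A M T (cv (A k) (u - w)) = 0) := by
  have hne : D A k ≠ D A (k - 1) := by
    rw [hu, hw]; rintro rfl
    rcases hp with ⟨rfl | rfl, h | h⟩ | ⟨rfl | rfl, h | h⟩ <;> simp at h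
  have h1 : ¬ On (cv (A k) (u - w)) (A (k - 1)) := by
    rw [A_pred A, hu]; clear hu hw hne
    rcases hp with (⟨rfl | rfl, rfl | rfl⟩ | ⟨rfl | rfl, rfl | rfl⟩) <;> simp [On, cv]
  have h2 : ¬ On (cv (A k) (u - w)) (A (k + 1)) := by
    rw [A_succ A, hw]; clear hu hw hne
    rcases hp with (⟨rfl | rfl, rfl | rfl⟩ | ⟨rfl | rfl, rfl | rfl⟩) <;> simp [On, cv]
  rw [c.mu_local (hp.on_cv (A k)).2.1, c.mrk_off h1, c.mrk_off h2, add_zero, zero_add]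
  constructor
  · intro h
    exact mrk_outer ⟨hne, by rw [h, hu]⟩ (c.perp hne) (by rw [hu, hw])
  · intro h
    exact mrk_nsp (fun hs => h (by rw [hs.2, hu]))

lemma mu_b2 [NeZero n] {M T : ℤ} {k : ZMod n} {u w : Pt} (hu : D A (k - 1) = u) (hw : D A k = w)
    (hp : Perp u w) :
    (D A (k + 1) = u → mu A M T (cv (A k) (w - u)) = - Sz M u (cv (A k) (w - u))) ∧
    (D A (k + 1) ≠ u → mu A M T (cv (A k) (w - u)) = 0) := by
  have hne : D A k ≠ D A (k - 1) := by
    rw [hu, hw]; rintro rfl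
    rcases hp with ⟨rfl | rfl, h | h⟩ | ⟨rfl | rfl, h | h⟩ <;> simp at h
  have hon := c.inn_on (c.perp hne)
  rw [hu, hw] at hon
  have h1 : mrk A M T (k - 1) (cv (A k) (w - u)) = 0 := by
    apply mrk_zero
    rintro ⟨hs1, hs2⟩
    rw [sub_add_cancel, hw] at hs2
    rw [← hs2, hu, A_pred A k, hu]; clear hu hw hne hon hs1 hs2
    rcases hp with (⟨rfl | rfl, rfl | rfl⟩ | ⟨rfl | rfl, rfl | rfl⟩) <;> simp [cv, Prod.ext_iff] <;> omega
  have h2 : mrk A M T (k + 1) (cv (A k) (w - u)) = 0 := by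
    apply mrk_zero
    rintro ⟨hs1, hs2⟩
    have hq := c.perp hs1
    rw [add_sub_cancel_right, hw] at hq hs1
    rw [add_sub_cancel_right, hw, A_succ A k, hw]
    have hx : D A (k + 1) ≠ - u := by
      intro hx
      refine c.far3 (i := k - 1) hon.2 ?_
      have : k - 1 + 3 = k + 2 := by ring
      rw [this, A_succ2 A, hw, hx]
      clear hu hw hne hon hs1 hs2 hx
      rcases hp with (⟨rfl | rfl, rfl | rfl⟩ | ⟨rfl | rfl, rfl | rfl⟩) <;> simp [cv, On]
    revert hq hx
    generalize D A (k + 1) = y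
    clear hu hw hne hon hs1 hs2
    rcases hp with (⟨rfl | rfl, rfl | rfl⟩ | ⟨rfl | rfl, rfl | rfl⟩) <;> simp [cv, Perp, Prod.ext_iff] <;>
      rintro (⟨h1, h2⟩ | ⟨h1, h2⟩) <;> simp [h1, h2]
  rw [c.mu_local (hp.on_cv (A k)).1, h1, h2, add_zero, zero_add]
  constructor
  · intro h
    rw [mrk_inner ⟨hne, by rw [h, hu]⟩ (c.perp hne) (by rw [hu, hw]), hu]
  · intro h
    exact mrk_nsp (fun hs => h (by rw [hs.2, hu]))

lemma mu_a2 [NeZero n] {M T : ℤ} {k : ZMod n} {u w : Pt} (hu : D A (k - 1) = u) (hw : D A k = w)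
    (hp : Perp u w) :
    (D A (k + 1) = u → mu A M T (cv (A k) (u + w)) = - Sz M w (cv (A k) (u + w)) ∨
      mu A M T (cv (A k) (u + w)) = 0) ∧
    (D A (k + 1) ≠ u → mu A M T (cv (A k) (u + w)) = 0) := by
  have h1 : ¬ On (cv (A k) (u + w)) (A (k - 1)) := by
    rw [A_pred A, hu]; clear hu hw
    rcases hp with (⟨rfl | rfl, rfl | rfl⟩ | ⟨rfl | rfl, rfl | rfl⟩) <;> simp [On, cv]
  have h2 : mrk A M T k (cv (A k) (u + w)) = 0 := by
    apply mrk_zero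
    intro _
    rw [hu, hw]; clear hu hw h1
    rcases hp with (⟨rfl | rfl, rfl | rfl⟩ | ⟨rfl | rfl, rfl | rfl⟩) <;> simp [cv, Prod.ext_iff]
  rw [c.mu_local (hp.on_cv (A k)).2.2.1, c.mrk_off h1, h2, add_zero, zero_add]
  have ee : k + 1 - 1 = k := by ring
  constructor
  · intro h
    by_cases hs : sp A (k + 1)
    · left
      rw [mrk_inner hs (c.perp hs.1), ee, hw]
      rw [ee, hw, h, A_succ A, hw]
      clear hu hw h1 h2 hs
      rcases hp with (⟨rfl | rfl, rfl | rfl⟩ | ⟨rfl | rfl, rfl | rfl⟩) <;> simp [cv, Prod.ext_iff]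
    · right; exact mrk_nsp hs
  · intro h
    apply mrk_zero
    rintro ⟨hs1, hs2⟩
    have hq := c.perp hs1
    rw [ee, hw] at hq
    rw [ee, hw, A_succ A k, hw]
    revert hq h
    generalize D A (k + 1) = y
    clear hu hw h1 h2 hs1 hs2
    rcases hp with (⟨rfl | rfl, rfl | rfl⟩ | ⟨rfl | rfl, rfl | rfl⟩) <;> simp [cv, Perp, Prod.ext_iff] <;>
      intro h <;> rintro (⟨h1, h2⟩ | ⟨h1, h2⟩) <;> simp [h1, h2] at h ⊢

lemma mu_b1 [NeZero n] {M T : ℤ} {k : ZMod n} {u w : Pt} (hu : D A (k - 1) = u) (hw : D A k = w)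
    (hp : Perp u w) :
    (D A (k - 2) = w → mu A M T (cv (A k) (-u - w)) = - Sz M w (cv (A k) (-u - w))) ∧
    (D A (k - 2) ≠ w → mu A M T (cv (A k) (-u - w)) = 0) := by
  have h1 : ¬ On (cv (A k) (-u - w)) (A (k + 1)) := by
    rw [A_succ A, hw]; clear hu hw
    rcases hp with (⟨rfl | rfl, rfl | rfl⟩ | ⟨rfl | rfl, rfl | rfl⟩) <;> simp [On, cv]
  have h2 : mrk A M T k (cv (A k) (-u - w)) = 0 := by
    apply mrk_zero
    intro _
    rw [hu, hw]; clear hu hw h1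
    rcases hp with (⟨rfl | rfl, rfl | rfl⟩ | ⟨rfl | rfl, rfl | rfl⟩) <;> simp [cv, Prod.ext_iff]
  rw [c.mu_local (hp.on_cv (A k)).2.2.2, c.mrk_off h1, h2, add_zero, add_zero]
  have ee : k - 1 - 1 = k - 2 := by ring
  have ef : k - 1 + 1 = k := by ring
  constructor
  · intro h
    have hne : D A (k - 1) ≠ D A (k - 1 - 1) := by
      rw [ee, h, hu]; rintro rfl
      rcases hp with ⟨rfl | rfl, h | h⟩ | ⟨rfl | rfl, h | h⟩ <;> simp at h
    rw [mrk_inner ⟨hne, by rw [ee, ef, h, hw]⟩ (c.perp hne), ee, h]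
    rw [ee, h, hu, A_pred A, hu]
    clear hu hw h1 h2 hne
    rcases hp with (⟨rfl | rfl, rfl | rfl⟩ | ⟨rfl | rfl, rfl | rfl⟩) <;> simp [cv, Prod.ext_iff]
  · intro h
    apply mrk_nsp
    rintro ⟨hs1, hs2⟩
    rw [ee, ef, hw] at hs2
    exact h hs2.symm

lemma mu_str [NeZero n] {M T : ℤ} {j : ZMod n} {u w : Pt} (hu : D A (j - 1) = u) (hw : D A j = u)
    (hp : Perp u w) : mu A M T (cv (A j) (-u - w)) = 0 := by
  have h1 : ¬ On (cv (A j) (-u - w)) (A (j + 1)) := by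
    rw [A_succ A, hw]; clear hu hw
    rcases hp with (⟨rfl | rfl, rfl | rfl⟩ | ⟨rfl | rfl, rfl | rfl⟩) <;> simp [On, cv]
  have h2 : mrk A M T j (cv (A j) (-u - w)) = 0 := by
    apply mrk_nsp
    rintro ⟨h, -⟩
    exact h (by rw [hu, hw])
  rw [c.mu_local (hp.on_cv (A j)).2.2.2, c.mrk_off h1, h2, add_zero, add_zero]
  apply mrk_nsp
  rintro ⟨hs1, hs2⟩
  rw [sub_add_cancel, hw] at hs2
  exact hs1 (by rw [hu, hs2])

end CPath


lemma Perp.neg_right {u w : Pt} (h : Perp u w) : Perp u (-w) := by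
  rcases h with (⟨rfl | rfl, rfl | rfl⟩ | ⟨rfl | rfl, rfl | rfl⟩) <;> simp [Perp]

lemma Perp.symm {u w : Pt} (h : Perp u w) : Perp w u := by
  rcases h with (⟨rfl | rfl, rfl | rfl⟩ | ⟨rfl | rfl, rfl | rfl⟩) <;> simp [Perp]

lemma Perp.ne {u w : Pt} (h : Perp u w) : u ≠ w ∧ u ≠ -w ∧ w ≠ -w := by
  rcases h with (⟨rfl | rfl, rfl | rfl⟩ | ⟨rfl | rfl, rfl | rfl⟩) <;> simp

namespace CPath
variable (c : CPath n A)
include c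

lemma cdelta [NeZero n] {M T : ℤ} {j : ZMod n} {u w : Pt} (hu : D A j = u) (hp : Perp u w)
    (hn : D A (j + 1) ≠ -w) :
    (D A (j - 1) ≠ w ∧ mu A M T (cv (A j) (-u - w)) = 0 ∧ (mu A M T (cv (A j) (w - u)) = 0 ∨
      mu A M T (cv (A j) (w - u)) = - Sz M u (cv (A j) (w - u)))) ∨
    (D A (j - 1) = w ∧ (mu A M T (cv (A j) (-u - w)) = 0 ∨
      mu A M T (cv (A j) (-u - w)) = - Sz M u (cv (A j) (-u - w))) ∧
      (D A (j + 1) = w → mu A M T (cv (A j) (w - u)) = T) ∧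
      (D A (j + 1) ≠ w → mu A M T (cv (A j) (w - u)) = 0)) := by
  by_cases h1 : D A (j - 1) = u
  · left
    refine ⟨by rw [h1]; exact hp.ne.1, c.mu_str h1 hu hp, Or.inl ?_⟩
    have := c.mu_str (M := M) (T := T) h1 hu hp.neg_right
    rwa [show -u - -w = w - u by abel] at this
  · have h2 : D A (j - 1) = w ∨ D A (j - 1) = -w := by
      have h3 := c.perp (i := j) (by rw [hu]; exact fun h => h1 h.symm)
      rw [hu] at h3
      revert h3
      generalize D A (j - 1) = y
      clear h1 hn hu
      rcases hp with (⟨rfl | rfl, rfl | rfl⟩ | ⟨rfl | rfl, rfl | rfl⟩) <;>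
        simp [Perp] <;> tauto
    rcases h2 with h2 | h2
    · right
      have ha := c.mu_a1 (M := M) (T := T) h2 hu hp.symm
      have hb := c.mu_b1 (M := M) (T := T) h2 hu hp.symm
      rw [show -w - u = -u - w by abel] at hb
      refine ⟨h2, ?_, ha⟩
      by_cases h4 : D A (j - 2) = u
      · exact Or.inr (hb.1 h4)
      · exact Or.inl (hb.2 h4)
    · left
      have ha := c.mu_a1 (M := M) (T := T) h2 hu hp.neg_right.symm
      have hb := c.mu_b1 (M := M) (T := T) h2 hu hp.neg_right.symm
      rw [show -w - u = -u - w by abel] at ha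
      rw [show - -w - u = w - u by abel] at hb
      refine ⟨by rw [h2]; exact hp.ne.2.2.symm, ha.2 hn, ?_⟩
      by_cases h4 : D A (j - 2) = u
      · exact Or.inr (hb.1 h4)
      · exact Or.inl (hb.2 h4)

/-- all coordinates are bounded by `L` -/
lemma Sz_bd {L : ℤ} {u w : Pt} (hp : Perp u w) {v : Pt}
    (hv : -L ≤ v.1 ∧ v.1 ≤ L ∧ -L ≤ v.2 ∧ v.2 ≤ L) :
    1 ≤ Sz (L + 1) u v ∧ Sz (L + 1) u v ≤ 2 * L + 1 := by
  clear c
  unfold Sz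
  rcases hp with (⟨rfl | rfl, rfl | rfl⟩ | ⟨rfl | rfl, rfl | rfl⟩) <;> simp <;> omega

lemma claim [NeZero n] {L : ℤ}
    (hL : ∀ i v, On v (A i) → -L ≤ v.1 ∧ v.1 ≤ L ∧ -L ≤ v.2 ∧ v.2 ≤ L)
    {k j : ZMod n} {N : ℤ} {u w : Pt}
    (hu : D A (k - 1) = u) (hw : D A k = w) (hp : Perp u w) (hj : D A j = u)
    (hN : 1 ≤ N)
    (hA : A j = ((A k).1 - N * u.1, (A k).2 - N * u.2))
    (hc : j + 1 = k ∨ (D A (j + 1) = u ∧ D A (k - 2) = u))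
    {a b d : ℤ}
    (ha : a = mu A (L + 1) (4 * L + 4) (cv (A k) (u - w)) -
      mu A (L + 1) (4 * L + 4) (cv (A k) (u + w)))
    (hb : b = mu A (L + 1) (4 * L + 4) (cv (A k) (-u - w)) -
      mu A (L + 1) (4 * L + 4) (cv (A k) (w - u)))
    (hd : d = mu A (L + 1) (4 * L + 4) (cv (A j) (-u - w)) -
      mu A (L + 1) (4 * L + 4) (cv (A j) (w - u))) :
    (d < a ∧ d < b) ∨ (D A (k + 1) ≠ u ∧ a = b) := by
  have hne := hp.ne
  have hn : D A (j + 1) ≠ -w := by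
    rcases hc with rfl | ⟨h, -⟩
    · rw [hw]; exact hne.2.2
    · rw [h]; exact hne.2.1
  have hon := hp.on_cv (A k)
  have hon' := hp.on_cv (A j)
  have ba2 := c.Sz_bd hp.symm (hL k _ hon.2.2.1)
  have bb1 := c.Sz_bd hp.symm (hL k _ hon.2.2.2)
  have bb2 := c.Sz_bd hp (hL k _ hon.1)
  have bc1 := c.Sz_bd hp (hL j _ hon'.2.2.2)
  have bc2 := c.Sz_bd hp (hL j _ hon'.1)
  have hS : Sz (L + 1) u (cv (A j) (w - u)) = Sz (L + 1) u (cv (A k) (w - u)) - N := by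
    rw [hA]; clear ha hb hd hon hon' hu hw hj hA hc hne hn ba2 bb1 bb2 bc1 bc2
    rcases hp with (⟨rfl | rfl, rfl | rfl⟩ | ⟨rfl | rfl, rfl | rfl⟩) <;> simp [Sz, cv] <;> ring
  have ea1 := c.mu_a1 (M := L + 1) (T := 4 * L + 4) hu hw hp
  have ea2 := c.mu_a2 (M := L + 1) (T := 4 * L + 4) hu hw hp
  have eb1 := c.mu_b1 (M := L + 1) (T := 4 * L + 4) hu hw hp
  have eb2 := c.mu_b2 (M := L + 1) (T := 4 * L + 4) hu hw hp
  have ec := c.cdelta (M := L + 1) (T := 4 * L + 4) hj hp hn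
  have h2 : D A (k - 2) = w → D A (j - 1) = w ∧ D A (j + 1) = w := by
    intro h
    rcases hc with rfl | ⟨-, h'⟩
    · refine ⟨?_, hw⟩
      rw [← h]
      congr 1; ring
    · exact absurd (h'.symm.trans h) hne.1
  by_cases hs : D A (k + 1) = u
  · left
    replace ea1 := ea1.1 hs
    replace ea2 := ea2.1 hs
    replace eb2 := eb2.1 hs
    by_cases hk : D A (k - 2) = w
    · replace eb1 := eb1.1 hk
      obtain ⟨h3, h4⟩ := h2 hk
      rcases ec with ⟨h, -⟩ | ⟨-, h5, h6, -⟩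
      · exact absurd h3 h
      · have h6 := h6 h4
        omega
    · replace eb1 := eb1.2 hk
      by_cases hjw : D A (j + 1) = w <;> simp only [hjw, ne_eq, not_true,
        not_false_eq_true, true_imp_iff, false_imp_iff, and_true, true_and] at ec <;> omega
  · replace ea1 := ea1.2 hs
    replace ea2 := ea2.2 hs
    replace eb2 := eb2.2 hs
    by_cases hk : D A (k - 2) = w
    · replace eb1 := eb1.1 hk
      obtain ⟨h3, h4⟩ := h2 hk
      rcases ec with ⟨h, -⟩ | ⟨-, h5, h6, -⟩
      · exact absurd h3 h
      · have h6 := h6 h4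
        omega
    · replace eb1 := eb1.2 hk
      right; exact ⟨hs, by omega⟩
end CPath


/-- The integral weight. -/
noncomputable def Wz (A : ZMod n → Pt) [NeZero n] (L : ℤ) (v : Pt) : ℤ :=
  v.1 * v.2 + (2 * L + 1) * mu A (L + 1) (4 * L + 4) v

namespace CPath
variable (c : CPath n A)
include c

lemma straight {k : ZMod n} {u : Pt} (hu : D A (k - 1) = u) (N : ℕ)
    (hl : ∀ l : ℕ, l ≤ N → ∃ i, A i = ((A k).1 - l * u.1, (A k).2 - l * u.2)) (l : ℕ) (h : l ≤ N) :
    A (k - l) = ((A k).1 - l * u.1, (A k).2 - l * u.2) := by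
  have hU := c.isU (k - 1)
  rw [hu] at hU
  induction l using Nat.strong_induction_on with
  | _ l ih =>
    match l, ih, h with
    | 0, _, _ => simp
    | 1, _, _ =>
      have := A_pred A k
      rw [hu] at this
      simp [this, Prod.ext_iff]
    | l + 2, ih, h =>
      have i1 := ih (l + 1) (by omega) (by omega)
      have i0 := ih l (by omega) (by omega)
      obtain ⟨i, hi⟩ := hl (l + 2) h
      have hi2 : A i = A (k - ((l + 1 : ℕ) : ZMod n)) + (-u) := by
        rw [hi, i1]
        simp [Prod.ext_iff]; constructor <;> ring
      have hU' : IsU (-u) := by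
        rcases hU with rfl | rfl | rfl | rfl <;> simp [IsU]
      rcases c.adjIdx hU' hi2 with e | e
      · rw [← hi, e]; congr 1; push_cast; ring
      · have : i = k - (l : ZMod n) := by rw [e]; push_cast; ring
        rw [this, i0] at hi
        simp [Prod.ext_iff] at hi
        exfalso
        rcases hU with rfl | rfl | rfl | rfl <;> simp at hi

lemma wclaim [NeZero n] {L : ℤ}
    (hL : ∀ i v, On v (A i) → -L ≤ v.1 ∧ v.1 ≤ L ∧ -L ≤ v.2 ∧ v.2 ≤ L)
    {k : ZMod n} {N : ℕ} {u w : Pt}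
    (hu : D A (k - 1) = u) (hw : D A k = w) (hp : Perp u w) (hN : 1 ≤ N)
    (hl : ∀ l : ℕ, l ≤ N → ∃ i, A i = ((A k).1 - l * u.1, (A k).2 - l * u.2))
    {a b d : ℤ} {q : Pt} (hq : q = ((A k).1 - N * u.1, (A k).2 - N * u.2))
    (ha : a = Wz A L (cv (A k) (u - w)) - Wz A L (cv (A k) (u + w)))
    (hb : b = Wz A L (cv (A k) (-u - w)) - Wz A L (cv (A k) (w - u)))
    (hd : d = Wz A L (cv q (-u - w)) - Wz A L (cv q (w - u))) :
    (d < a ∧ d < b) ∨ (D A (k + 1) ≠ u ∧ a < d ∧ b < d) := by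
  have hst := c.straight hu N hl
  have hDst : ∀ l : ℕ, 1 ≤ l → l ≤ N → D A (k - l) = u := by
    intro l h1 h2
    obtain ⟨m, rfl⟩ : ∃ m, l = m + 1 := ⟨l - 1, by omega⟩
    have e1 := hst (m + 1) h2
    have e0 := hst m (by omega)
    have : k - ((m + 1 : ℕ) : ZMod n) + 1 = k - m := by push_cast; ring
    rw [D, this, e1, e0]
    simp [Prod.ext_iff]
    constructor <;> ring
  set j : ZMod n := k - N with hj
  have hqj : A j = q := by rw [hq, hst N le_rfl]
  have hcl := c.claim hL (j := j) (N := N) hu hw hp (hDst N hN le_rfl) (by exact_mod_cast hN)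
    (hst N le_rfl) (by
      rcases Nat.eq_or_lt_of_le hN with h | h
      · left; rw [hj, ← h]; simp
      · right
        constructor
        · have := hDst (N - 1) (by omega) (by omega)
          rw [← this, hj]; congr 1
          rw [Nat.cast_sub hN]; push_cast; ring
        · have := hDst 2 (by omega) (by omega)
          exact_mod_cast this) rfl rfl rfl
  rw [hqj] at hcl
  have hb1 := hL k _ (hp.on_cv (A k)).2.1
  have hb2 := hL j _ (hp.on_cv (A j)).2.2.2
  rw [hqj] at hb2
  set a' := mu A (L + 1) (4 * L + 4) (cv (A k) (u - w)) -
      mu A (L + 1) (4 * L + 4) (cv (A k) (u + w)) with ha'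
  set b' := mu A (L + 1) (4 * L + 4) (cv (A k) (-u - w)) -
      mu A (L + 1) (4 * L + 4) (cv (A k) (w - u)) with hb'
  set d' := mu A (L + 1) (4 * L + 4) (cv q (-u - w)) -
      mu A (L + 1) (4 * L + 4) (cv q (w - u)) with hd'
  have key : (N : ℤ) + 1 ≤ 2 * L ∧ ∃ s : ℤ, (s = 1 ∨ s = -1) ∧
      a - d = s * (N + 1) + (2 * L + 1) * (a' - d') ∧ b - d = s * N + (2 * L + 1) * (b' - d') := by
    have e1 : a - d = (cv (A k) (u - w)).1 * (cv (A k) (u - w)).2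
       - (cv (A k) (u + w)).1 * (cv (A k) (u + w)).2 -
       ((cv q (-u - w)).1 * (cv q (-u - w)).2 - (cv q (w - u)).1 * (cv q (w - u)).2)
       + (2 * L + 1) * (a' - d') := by
      rw [ha, hd, ha', hd']; unfold Wz; ring
    have e2 : b - d = (cv (A k) (-u - w)).1 * (cv (A k) (-u - w)).2
       - (cv (A k) (w - u)).1 * (cv (A k) (w - u)).2 -
       ((cv q (-u - w)).1 * (cv q (-u - w)).2 - (cv q (w - u)).1 * (cv q (w - u)).2)
       + (2 * L + 1) * (b' - d') := by
      rw [hb, hd, hb', hd']; unfold Wz; ring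
    rw [e1, e2]
    clear_value a' b' d' j
    clear e1 e2 ha hb hd hcl hqj hj hst hDst hl hu hw
    subst hq
    rcases hp with (⟨rfl | rfl, rfl | rfl⟩ | ⟨rfl | rfl, rfl | rfl⟩) <;>
      simp [cv] at hb1 hb2 ⊢ <;> refine ⟨by omega, ?_⟩
    · right; constructor <;> ring
    · left; constructor <;> ring
    · left; constructor <;> ring
    · right; constructor <;> ring
    · right; constructor <;> ring
    · left; constructor <;> ring
    · left; constructor <;> ring
    · right; constructor <;> ring
  obtain ⟨hNL, s, hs, e1, e2⟩ := key
  clear_value a' b' d'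
  have hN' : (1 : ℤ) ≤ N := by exact_mod_cast hN
  have pos : ∀ x : ℤ, 0 < x → 2 * L + 1 ≤ (2 * L + 1) * x := by
    intro x hx; nlinarith
  have neg : ∀ x : ℤ, x < 0 → (2 * L + 1) * x ≤ - (2 * L + 1) := by
    intro x hx; nlinarith
  rcases hcl with ⟨h1, h2⟩ | ⟨h0, h1⟩
  · left
    have := pos (a' - d') (by omega)
    have := pos (b' - d') (by omega)
    rcases hs with rfl | rfl <;> constructor <;> linarith
  · rw [h1] at e1
    rcases lt_trichotomy (b' - d') 0 with h | h | h
    · have := neg _ h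
      right
      rcases hs with rfl | rfl <;> refine ⟨h0, ?_, ?_⟩ <;> linarith
    · rw [h] at e1 e2
      rcases hs with rfl | rfl
      · left; constructor <;> linarith
      · right; refine ⟨h0, ?_, ?_⟩ <;> linarith
    · have := pos _ h
      left
      rcases hs with rfl | rfl <;> constructor <;> linarith

end CPath


/-- Being a cell of the path. -/
def Cl (A : ZMod n → Pt) (q : Pt) : Prop := ∃ i, A i = q

/-- All cells of the box are in the path. -/
def Bx (A : ZMod n → Pt) (x1 x2 y1 y2 : ℤ) : Prop :=
  ∀ p q, min x1 x2 ≤ p → p < max x1 x2 → min y1 y2 ≤ q → q < max y1 y2 → Cl A (p, q)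

/-- Same strict sign. -/
def SS (x y : ℤ) : Prop := (0 < x ∧ 0 < y) ∨ (x < 0 ∧ y < 0)

/-- `i` is next to `o` and strictly between `o` and `e`. -/
def Bt (o i e : ℤ) : Prop := (i = o + 1 ∧ i < e) ∨ (i = o - 1 ∧ e < i)

lemma Bt.param {o i e : ℤ} (h : Bt o i e) :
    ∃ s : ℤ, (s = 1 ∨ s = -1) ∧ i = o + s ∧ ∃ N : ℕ, 1 ≤ N ∧ e = o + s * (N + 1) := by
  rcases h with ⟨h1, h2⟩ | ⟨h1, h2⟩
  · refine ⟨1, Or.inl rfl, h1, (e - o - 1).toNat, by omega, by omega⟩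
  · refine ⟨-1, Or.inr rfl, by omega, (o - e - 1).toNat, by omega, by omega⟩

namespace CPath
variable (c : CPath n A)
include c

lemma ladj [NeZero n] {L : ℤ}
    (hL : ∀ i v, On v (A i) → -L ≤ v.1 ∧ v.1 ≤ L ∧ -L ≤ v.2 ∧ v.2 ≤ L)
    {ox ix cx oy iy ry : ℤ} (hx : Bt ox ix cx) (hy : Bt oy iy ry)
    (h1 : Bx A ox cx oy iy) (h2 : Bx A ox ix oy ry) :
    SS (Wz A L (ox, oy) + Wz A L (cx, iy) - Wz A L (ox, iy) - Wz A L (cx, oy))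
      (Wz A L (ix, oy) + Wz A L (cx, iy) - Wz A L (ix, iy) - Wz A L (cx, oy)) ∨
    SS (Wz A L (ox, oy) + Wz A L (ix, ry) - Wz A L (ix, oy) - Wz A L (ox, ry))
      (Wz A L (ox, iy) + Wz A L (ix, ry) - Wz A L (ix, iy) - Wz A L (ox, ry)) := by
  obtain ⟨sx, hsx, rfl, N, hN, rfl⟩ := hx.param
  obtain ⟨sy, hsy, rfl, N', hN', rfl⟩ := hy.param
  have hl1 : ∀ l : ℕ, l ≤ N → Cl A (ox + (sx - 1) / 2 + l * sx, oy + (sy - 1) / 2) := by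
    intro l hl
    apply h1 <;> rcases hsx with rfl | rfl <;> rcases hsy with rfl | rfl <;> simp <;> omega
  have hl2 : ∀ l : ℕ, l ≤ N' → Cl A (ox + (sx - 1) / 2, oy + (sy - 1) / 2 + l * sy) := by
    intro l hl
    apply h2 <;> rcases hsx with rfl | rfl <;> rcases hsy with rfl | rfl <;> simp <;> omega
  obtain ⟨k, hk⟩ := hl1 0 (by omega)
  obtain ⟨kh, hkh⟩ := hl1 1 (by omega)
  obtain ⟨kv, hkv⟩ := hl2 1 (by omega)
  simp only [Nat.cast_zero, zero_mul, add_zero, Nat.cast_one, one_mul] at hk hkh hkv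
  have ih := c.adjIdx (j := kh) (k := k) (u := (sx, 0))
    (by rcases hsx with rfl | rfl <;> simp [IsU]) (by rw [hkh, hk]; simp)
  have iv := c.adjIdx (j := kv) (k := k) (u := (0, sy))
    (by rcases hsy with rfl | rfl <;> simp [IsU]) (by rw [hkv, hk]; simp)
  have hne : kh ≠ kv := by
    rintro rfl
    rw [hkh] at hkv
    simp at hkv
    rcases hsx with rfl | rfl <;> simp at hkv
  have hcase : (kh = k - 1 ∧ kv = k + 1) ∨ (kv = k - 1 ∧ kh = k + 1) := by
    rcases ih with h | h <;> rcases iv with h' | h'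
    · exact absurd (h.trans h'.symm) hne
    · exact Or.inl ⟨h, h'⟩
    · exact Or.inr ⟨h', h⟩
    · exact absurd (h.trans h'.symm) hne
  rcases hcase with ⟨rfl, rfl⟩ | ⟨rfl, rfl⟩
  · left
    have hp : Perp (-sx, 0) (0, sy) := by
      rcases hsx with rfl | rfl <;> rcases hsy with rfl | rfl <;> simp [Perp]
    have hu : D A (k - 1) = (-sx, 0) := by simp [D, hk, hkh]
    have hw : D A k = (0, sy) := by simp [D, hk, hkv]
    have h := c.wclaim hL hu hw hp hN (by
      intro l hl; rw [hk]; simpa [Cl] using hl1 l hl) rfl rfl rfl rfl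
    rw [hk] at h
    rcases hsx with rfl | rfl <;> rcases hsy with rfl | rfl <;> simp [cv] at h <;>
      ring_nf at h ⊢ <;> unfold SS <;> omega
  · right
    have hp : Perp (0, -sy) (sx, 0) := by
      rcases hsx with rfl | rfl <;> rcases hsy with rfl | rfl <;> simp [Perp]
    have hu : D A (k - 1) = (0, -sy) := by simp [D, hk, hkv]
    have hw : D A k = (sx, 0) := by simp [D, hk, hkh]
    have h := c.wclaim hL hu hw hp hN' (by
      intro l hl; rw [hk]; simpa [Cl] using hl2 l hl) rfl rfl rfl rfl
    rw [hk] at h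
    rcases hsx with rfl | rfl <;> rcases hsy with rfl | rfl <;> simp [cv] at h <;>
      ring_nf at h ⊢ <;> unfold SS <;> omega

end CPath


lemma Bx.sub {x1 x2 y1 y2 x1' x2' y1' y2' : ℤ} (h : Bx A x1 x2 y1 y2)
    (e1 : min x1 x2 ≤ min x1' x2') (e2 : max x1' x2' ≤ max x1 x2)
    (e3 : min y1 y2 ≤ min y1' y2') (e4 : max y1' y2' ≤ max y1 y2) : Bx A x1' x2' y1' y2' :=
  fun p q h1 h2 h3 h4 => h p q (e1.trans h1) (h2.trans_le e2) (e3.trans h3) (h4.trans_le e4)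

lemma Bx.hunion {a p r y1 y2 : ℤ} (h : Bx A a p y1 y2) (h' : Bx A a r y1 y2) : Bx A p r y1 y2 := by
  intro x y h1 h2 h3 h4
  by_cases hc : min a p ≤ x ∧ x < max a p
  · exact h x y hc.1 hc.2 h3 h4
  · exact h' x y (by omega) (by omega) h3 h4

lemma Bx.vunion {a p r y1 y2 : ℤ} (h : Bx A y1 y2 a p) (h' : Bx A y1 y2 a r) : Bx A y1 y2 p r := by
  intro x y h1 h2 h3 h4
  by_cases hc : min a p ≤ y ∧ y < max a p
  · exact h x y h1 h2 hc.1 hc.2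
  · exact h' x y h1 h2 (by omega) (by omega)

lemma Bx.swapx {x1 x2 y1 y2 : ℤ} (h : Bx A x1 x2 y1 y2) : Bx A x2 x1 y1 y2 :=
  h.sub (by omega) (by omega) (by omega) (by omega)

lemma Bx.swapy {x1 x2 y1 y2 : ℤ} (h : Bx A x1 x2 y1 y2) : Bx A x1 x2 y2 y1 :=
  h.sub (by omega) (by omega) (by omega) (by omega)

lemma Bx.on {x1 x2 y1 y2 : ℤ} (h : Bx A x1 x2 y1 y2) (h1 : x1 ≠ x2) (h2 : y1 ≠ y2) :
    ∃ i, On (x1, y1) (A i) := by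
  obtain ⟨i, hi⟩ := h (if x1 < x2 then x1 else x1 - 1) (if y1 < y2 then y1 else y1 - 1)
    (by split_ifs <;> omega) (by split_ifs <;> omega) (by split_ifs <;> omega)
    (by split_ifs <;> omega)
  refine ⟨i, ?_⟩
  rw [hi]
  unfold On
  refine ⟨?_, ?_, ?_, ?_⟩ <;> simp only <;> split_ifs <;> omega

/-- The moves. -/
def mv (A : ZMod n → Pt) (x y z t : Pt) : Prop :=
  x.1 ≠ y.1 ∧ x.2 ≠ y.2 ∧ Bx A x.1 y.1 x.2 y.2 ∧
    ((z = (x.1, y.2) ∧ t = (y.1, x.2)) ∨ (z = (y.1, x.2) ∧ t = (x.1, y.2)))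

lemma ust {x1 x2 y1 y2 : ℤ} (h : Bx A x1 x2 y1 y2) (h1 : x1 ≠ x2) (h2 : y1 ≠ y2)
    (s : Pt →₀ ℕ) {m m' : Pt →₀ ℕ} (hm : m = s + prs (x1, y1) (x2, y2))
    (hm' : m' = s + prs (x1, y2) (x2, y1)) : UStep (mv A) m m' :=
  ⟨s, _, _, _, _, ⟨h1, h2, h, Or.inl ⟨rfl, rfl⟩⟩, hm, hm'⟩

lemma mv_symm {x y z t : Pt} (h : mv A x y z t) : mv A z t x y := by
  obtain ⟨h1, h2, h3, ⟨rfl, rfl⟩ | ⟨rfl, rfl⟩⟩ := h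
  · exact ⟨h1, h2.symm, h3.swapy, Or.inl ⟨rfl, rfl⟩⟩
  · exact ⟨h1.symm, h2, h3.swapx, Or.inr ⟨rfl, rfl⟩⟩

/-- Two monomials are connected below `B`. -/
def CG (A : ZMod n → Pt) (W : Pt → ℕ) (B : ℕ) (m m' : Pt →₀ ℕ) : Prop :=
  UStep (mv A) m m' ∨ ∃ e, UStep (mv A) m e ∧ UStep (mv A) e m' ∧ Finsupp.weight W e < B

lemma ustep_symm {m m' : Pt →₀ ℕ} (h : UStep (mv A) m m') : UStep (mv A) m' m := by
  obtain ⟨s, x, y, z, t, h, h1, h2⟩ := h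
  exact ⟨s, z, t, x, y, mv_symm h, h2, h1⟩

lemma CG.symm {W : Pt → ℕ} {B : ℕ} {m m' : Pt →₀ ℕ} (h : CG A W B m m') : CG A W B m' m := by
  rcases h with h | ⟨e, h1, h2, h3⟩
  · exact Or.inl (ustep_symm h)
  · exact Or.inr ⟨e, ustep_symm h2, ustep_symm h1, h3⟩

namespace CPath
variable (c : CPath n A)
include c

lemma thin {x y : ℤ} (h1 : Cl A (x, y)) (h2 : Cl A (x + 1, y)) (h3 : Cl A (x, y + 1))
    (h4 : Cl A (x + 1, y + 1)) : False := by
  obtain ⟨i1, h1⟩ := h1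
  obtain ⟨i2, h2⟩ := h2
  obtain ⟨i3, h3⟩ := h3
  obtain ⟨i4, h4⟩ := h4
  have a12 := c.adjIdx (j := i2) (k := i1) (u := (1, 0)) (by simp [IsU]) (by simp [h1, h2])
  have a13 := c.adjIdx (j := i3) (k := i1) (u := (0, 1)) (by simp [IsU]) (by simp [h1, h3])
  have a24 := c.adjIdx (j := i4) (k := i2) (u := (0, 1)) (by simp [IsU]) (by simp [h4, h2])
  have a34 := c.adjIdx (j := i4) (k := i3) (u := (1, 0)) (by simp [IsU]) (by simp [h4, h3])
  have n23 : i2 ≠ i3 := by rintro rfl; rw [h2] at h3; simp at h3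
  have n14 : i1 ≠ i4 := by rintro rfl; rw [h1] at h4; simp at h4
  rcases a12 with rfl | rfl <;> rcases a13 with rfl | rfl <;> rcases a24 with rfl | rfl <;>
    rcases a34 with h | h <;>
    first
    | exact n23 rfl
    | exact n14 (by ring1)
    | exact n14 (by linear_combination -h)
    | exact c.ne4 (by linear_combination h)
    | exact c.ne4 (by linear_combination -h)
    | exact c.ne2 (by linear_combination h)
    | exact c.ne2 (by linear_combination -h)

lemma thinBox {x1 x2 y1 y2 : ℤ} (h : Bx A x1 x2 y1 y2) (h1 : x1 ≠ x2) (h2 : y1 ≠ y2) :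
    (x2 = x1 + 1 ∨ x2 = x1 - 1) ∨ (y2 = y1 + 1 ∨ y2 = y1 - 1) := by
  by_contra hc
  refine c.thin (x := min x1 x2) (y := min y1 y2) ?_ ?_ ?_ ?_ <;> apply h <;> omega

variable {W : Pt → ℕ} {C L : ℤ} [NeZero n]
  (hL : ∀ i v, On v (A i) → -L ≤ v.1 ∧ v.1 ≤ L ∧ -L ≤ v.2 ∧ v.2 ≤ L)
  (hW : ∀ i v, On v (A i) → (W v : ℤ) = Wz A L v + C)

include hW in
lemma hW4 {x1 x2 y1 y2 : ℤ} (h : Bx A x1 x2 y1 y2) (h1 : x1 ≠ x2) (h2 : y1 ≠ y2) :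
    (W (x1, y1) : ℤ) = Wz A L (x1, y1) + C ∧ (W (x1, y2) : ℤ) = Wz A L (x1, y2) + C ∧
    (W (x2, y1) : ℤ) = Wz A L (x2, y1) + C ∧ (W (x2, y2) : ℤ) = Wz A L (x2, y2) + C := by
  obtain ⟨i1, e1⟩ := h.on h1 h2
  obtain ⟨i2, e2⟩ := h.swapy.on h1 h2.symm
  obtain ⟨i3, e3⟩ := h.swapx.on h1.symm h2
  obtain ⟨i4, e4⟩ := h.swapx.swapy.on h1.symm h2.symm
  exact ⟨hW _ _ e1, hW _ _ e2, hW _ _ e3, hW _ _ e4⟩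

include hL hW in
lemma lconf {ox ix cx oy iy ry : ℤ} (hx : Bt ox ix cx) (hy : Bt oy iy ry)
    (h1 : Bx A ox cx oy iy) (h2 : Bx A ox ix oy ry) {vx wx vy wy : ℤ}
    (hvx : (vx = ox ∧ wx = ix) ∨ (vx = ix ∧ wx = ox))
    (hvy : (vy = oy ∧ wy = iy) ∨ (vy = iy ∧ wy = oy))
    (l1 : W (vx, wy) + W (cx, vy) < W (vx, vy) + W (cx, wy))
    (l2 : W (vx, ry) + W (wx, vy) < W (vx, vy) + W (wx, ry)) :
    CG A W (W (vx, vy) + W (cx, wy) + W (wx, ry))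
      (prs (vx, wy) (cx, vy) + Finsupp.single (wx, ry) 1)
      (prs (vx, ry) (wx, vy) + Finsupp.single (cx, wy) 1) := by
  have hadj := c.ladj hL hx hy h1 h2
  unfold Bt at hx hy
  have b1 := c.hW4 hW h1 (by omega) (by omega)
  have b2 := c.hW4 hW h2 (by omega) (by omega)
  have b3 := c.hW4 hW (h1.sub (x1' := ox) (x2' := ix) (y1' := oy) (y2' := iy) (by omega) (by omega)
    (by omega) (by omega)) (by omega) (by omega)
  unfold SS at hadj
  right
  refine ⟨prs (wx, wy) (cx, vy) + Finsupp.single (vx, ry) 1, ?_, ?_, ?_⟩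
  · refine ust (x1 := vx) (x2 := wx) (y1 := wy) (y2 := ry) ?_ (by omega) (by omega)
      (Finsupp.single (cx, vy) 1) ?_ ?_
    · refine h2.sub ?_ ?_ ?_ ?_ <;> omega
    · simp only [prs]; abel
    · simp only [prs]; abel
  · refine ust (x1 := wx) (x2 := cx) (y1 := wy) (y2 := vy) ?_ (by omega) (by omega)
      (Finsupp.single (vx, ry) 1) ?_ ?_
    · refine h1.sub ?_ ?_ ?_ ?_ <;> omega
    · simp only [prs]; abel
    · simp only [prs]; abel
  · rw [map_add, weight_prs]
    simp only [Finsupp.weight_single, smul_eq_mul, one_mul]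
    rcases hvx with ⟨rfl, rfl⟩ | ⟨rfl, rfl⟩ <;> rcases hvy with ⟨rfl, rfl⟩ | ⟨rfl, rfl⟩ <;> omega

end CPath


namespace CPath
variable (c : CPath n A)
  {W : Pt → ℕ} {C L : ℤ} [NeZero n]
  (hL : ∀ i v, On v (A i) → -L ≤ v.1 ∧ v.1 ≤ L ∧ -L ≤ v.2 ∧ v.2 ≤ L)
  (hW : ∀ i v, On v (A i) → (W v : ℤ) = Wz A L v + C)
include c hL hW

lemma oppH {k : ZMod n} {a b sx sy : ℤ} (hsx : sx = 1 ∨ sx = -1) (hsy : sy = 1 ∨ sy = -1)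
    {X Y X' Y' : ℕ} (hX : 1 ≤ X) (hY : 1 ≤ Y) (hX' : 1 ≤ X') (hY' : 1 ≤ Y')
    (hu : D A (k - 1) = (sx, 0)) (hw : D A k = (0, sy))
    (hk : A k = (a + (sx - 1) / 2, b + (-sy - 1) / 2))
    {p q r s : ℤ} (ep : p = a + sx * X) (eq : q = b + sy * Y) (er : r = a - sx * X')
    (es : s = b - sy * Y')
    (h1 : Bx A a p b q) (h2 : Bx A a r b s)
    (l1 : W (a, q) + W (p, b) < W (a, b) + W (p, q))
    (l2 : W (a, s) + W (r, b) < W (a, b) + W (r, s)) :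
    CG A W (W (a, b) + W (p, q) + W (r, s)) (prs (a, q) (p, b) + Finsupp.single (r, s) 1)
      (prs (a, s) (r, b) + Finsupp.single (p, q) 1) := by
  have hk' : A (k - 1) = (a + (-sx - 1) / 2, b + (-sy - 1) / 2) := by
    rw [A_pred A, hu, hk]
    rcases hsx with rfl | rfl <;> simp <;> ring
  have hk1 : A (k + 1) = (a + (sx - 1) / 2, b + (sy - 1) / 2) := by
    rw [A_succ A, hw, hk]
    rcases hsy with rfl | rfl <;> simp
  have hp : Perp (sx, 0) (0, sy) := by
    rcases hsx with rfl | rfl <;> rcases hsy with rfl | rfl <;> simp [Perp]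
  have nr : a ≠ r := by rcases hsx with rfl | rfl <;> omega
  have ns : b ≠ s := by rcases hsy with rfl | rfl <;> omega
  have bw := c.hW4 hW h2 nr ns
  have ht := c.thinBox h2 nr ns
  by_cases c1 : 2 ≤ Y'
  · exfalso
    have e1 : X' = 1 := by rcases hsx with rfl | rfl <;> rcases hsy with rfl | rfl <;> omega
    subst e1
    obtain ⟨N, rfl⟩ : ∃ N, Y' = N + 1 := ⟨Y' - 1, by omega⟩
    have hl : ∀ l : ℕ, l ≤ N → Cl A (a + (-sx - 1) / 2, b + (-sy - 1) / 2 - l * sy) := by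
      intro l hl
      apply h2 <;> rcases hsx with rfl | rfl <;> rcases hsy with rfl | rfl <;> omega
    have hD : D A (k - 1 - 1) = (0, sy) := by
      obtain ⟨i, hi⟩ := hl 1 (by omega)
      rcases c.adjIdx (j := i) (k := k - 1) (u := (0, -sy))
        (by rcases hsy with rfl | rfl <;> simp [IsU]) (by rw [hi, hk']; simp; ring) with rfl | rfl
      · rw [D, sub_add_cancel, hk', hi]; simp
      · exfalso
        rw [sub_add_cancel, hk] at hi
        simp only [Prod.mk.injEq] at hi
        rcases hsy with rfl | rfl <;> omega
    have h := c.wclaim hL hD hu hp.symm (N := N) (by omega) (by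
      intro l h; rw [hk']; simpa [Cl] using hl l h) rfl rfl rfl rfl
    rw [hk', sub_add_cancel, hw] at h
    simp only [ne_eq, not_true, false_and, or_false] at h
    replace h := h.1
    subst er es
    rcases hsx with rfl | rfl <;> rcases hsy with rfl | rfl <;> simp [cv] at h bw l2 <;>
      ring_nf at h bw l2 <;> omega
  · have e1 : Y' = 1 := by omega
    subst e1
    by_cases c2 : 2 ≤ X
    · exfalso
      have hD : D A (k + 1) = (sx, 0) := by
        obtain ⟨i, hi⟩ := h1 (a + (sx - 1) / 2 + sx) (b + (sy - 1) / 2)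
          (by rcases hsx with rfl | rfl <;> omega)
          (by rcases hsx with rfl | rfl <;> omega)
          (by rcases hsy with rfl | rfl <;> omega)
          (by rcases hsy with rfl | rfl <;> omega)
        rcases c.adjIdx (j := i) (k := k + 1) (u := (sx, 0))
          (by rcases hsx with rfl | rfl <;> simp [IsU]) (by rw [hi, hk1]; simp) with rfl | rfl
        · exfalso
          rw [add_sub_cancel_right, hk] at hi
          simp only [Prod.mk.injEq] at hi
          rcases hsx with rfl | rfl <;> omega
        · rw [D, hk1, hi]; simp
      have hl : ∀ l : ℕ, l ≤ X' → Cl A (a + (sx - 1) / 2 - l * sx, b + (-sy - 1) / 2) := by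
        intro l hl
        by_cases h0 : l = 0
        · subst h0; exact ⟨k, by simp [hk]⟩
        apply h2 <;> rcases hsx with rfl | rfl <;> rcases hsy with rfl | rfl <;> omega
      have h := c.wclaim hL hu hw hp (N := X') (by omega) (by
        intro l h; rw [hk]; simpa [Cl] using hl l h) rfl rfl rfl rfl
      rw [hk, hD] at h
      simp only [ne_eq, not_true, false_and, or_false] at h
      replace h := h.2
      subst er es
      rcases hsx with rfl | rfl <;> rcases hsy with rfl | rfl <;> simp [cv] at h bw l2 <;>
        ring_nf at h bw l2 <;> omega
    · have e1 : X = 1 := by omega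
      subst e1
      have hc : ∀ x y, x = a + (sx - 1) / 2 → y = b + (-sy - 1) / 2 → Cl A (x, y) := by
        rintro x y rfl rfl; exact ⟨k, hk⟩
      have h := c.lconf hL hW (ox := p) (ix := a) (cx := r) (oy := s) (iy := b) (ry := q)
        (vx := a) (wx := p) (vy := b) (wy := s)
        (by unfold Bt; rcases hsx with rfl | rfl <;> omega)
        (by unfold Bt; rcases hsy with rfl | rfl <;> omega)
        (by
          intro x y g1 g2 g3 g4
          by_cases hx : min a r ≤ x ∧ x < max a r
          · apply h2 <;> omega
          · apply hc <;> rcases hsx with rfl | rfl <;> rcases hsy with rfl | rfl <;> omega)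
        (by
          intro x y g1 g2 g3 g4
          by_cases hx : min b q ≤ y ∧ y < max b q
          · apply h1 <;> omega
          · apply hc <;> rcases hsx with rfl | rfl <;> rcases hsy with rfl | rfl <;> omega)
        (Or.inr ⟨rfl, rfl⟩) (Or.inr ⟨rfl, rfl⟩) l2 l1
      have := h.symm
      rwa [add_right_comm] at this

end CPath


namespace CPath
variable (c : CPath n A)
  {W : Pt → ℕ} {C L : ℤ} [NeZero n]
  (hL : ∀ i v, On v (A i) → -L ≤ v.1 ∧ v.1 ≤ L ∧ -L ≤ v.2 ∧ v.2 ≤ L)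
  (hW : ∀ i v, On v (A i) → (W v : ℤ) = Wz A L v + C)
include c hL hW

lemma oppV {k : ZMod n} {a b sx sy : ℤ} (hsx : sx = 1 ∨ sx = -1) (hsy : sy = 1 ∨ sy = -1)
    {X Y X' Y' : ℕ} (hX : 1 ≤ X) (hY : 1 ≤ Y) (hX' : 1 ≤ X') (hY' : 1 ≤ Y')
    (hu : D A (k - 1) = (0, sy)) (hw : D A k = (sx, 0))
    (hk : A k = (a + (-sx - 1) / 2, b + (sy - 1) / 2))
    {p q r s : ℤ} (ep : p = a + sx * X) (eq : q = b + sy * Y) (er : r = a - sx * X')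
    (es : s = b - sy * Y')
    (h1 : Bx A a p b q) (h2 : Bx A a r b s)
    (l1 : W (a, q) + W (p, b) < W (a, b) + W (p, q))
    (l2 : W (a, s) + W (r, b) < W (a, b) + W (r, s)) :
    CG A W (W (a, b) + W (p, q) + W (r, s)) (prs (a, q) (p, b) + Finsupp.single (r, s) 1)
      (prs (a, s) (r, b) + Finsupp.single (p, q) 1) := by
  have hk' : A (k - 1) = (a + (-sx - 1) / 2, b + (-sy - 1) / 2) := by
    rw [A_pred A, hu, hk]
    rcases hsy with rfl | rfl <;> simp <;> ring
  have hk1 : A (k + 1) = (a + (sx - 1) / 2, b + (sy - 1) / 2) := by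
    rw [A_succ A, hw, hk]
    rcases hsx with rfl | rfl <;> simp
  have hp : Perp (0, sy) (sx, 0) := by
    rcases hsx with rfl | rfl <;> rcases hsy with rfl | rfl <;> simp [Perp]
  have nr : a ≠ r := by rcases hsx with rfl | rfl <;> omega
  have ns : b ≠ s := by rcases hsy with rfl | rfl <;> omega
  have bw := c.hW4 hW h2 nr ns
  have ht := c.thinBox h2 nr ns
  by_cases c1 : 2 ≤ X'
  · exfalso
    have e1 : Y' = 1 := by rcases hsx with rfl | rfl <;> rcases hsy with rfl | rfl <;> omega
    subst e1
    obtain ⟨N, rfl⟩ : ∃ N, X' = N + 1 := ⟨X' - 1, by omega⟩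
    have hl : ∀ l : ℕ, l ≤ N → Cl A (a + (-sx - 1) / 2 - l * sx, b + (-sy - 1) / 2) := by
      intro l hl
      apply h2 <;> rcases hsx with rfl | rfl <;> rcases hsy with rfl | rfl <;> omega
    have hD : D A (k - 1 - 1) = (sx, 0) := by
      obtain ⟨i, hi⟩ := hl 1 (by omega)
      rcases c.adjIdx (j := i) (k := k - 1) (u := (-sx, 0))
        (by rcases hsx with rfl | rfl <;> simp [IsU]) (by rw [hi, hk']; simp; ring) with rfl | rfl
      · rw [D, sub_add_cancel, hk', hi]; simp
      · exfalso
        rw [sub_add_cancel, hk] at hi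
        simp only [Prod.mk.injEq] at hi
        rcases hsx with rfl | rfl <;> omega
    have h := c.wclaim hL hD hu hp.symm (N := N) (by omega) (by
      intro l h; rw [hk']; simpa [Cl] using hl l h) rfl rfl rfl rfl
    rw [hk', sub_add_cancel, hw] at h
    simp only [ne_eq, not_true, false_and, or_false] at h
    replace h := h.1
    subst er es
    rcases hsx with rfl | rfl <;> rcases hsy with rfl | rfl <;> simp [cv] at h bw l2 <;>
      ring_nf at h bw l2 <;> omega
  · have e1 : X' = 1 := by omega
    subst e1
    by_cases c2 : 2 ≤ Y
    · exfalso
      have hD : D A (k + 1) = (0, sy) := by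
        obtain ⟨i, hi⟩ := h1 (a + (sx - 1) / 2) (b + (sy - 1) / 2 + sy)
          (by rcases hsx with rfl | rfl <;> omega)
          (by rcases hsx with rfl | rfl <;> omega)
          (by rcases hsy with rfl | rfl <;> omega)
          (by rcases hsy with rfl | rfl <;> omega)
        rcases c.adjIdx (j := i) (k := k + 1) (u := (0, sy))
          (by rcases hsy with rfl | rfl <;> simp [IsU]) (by rw [hi, hk1]; simp) with rfl | rfl
        · exfalso
          rw [add_sub_cancel_right, hk] at hi
          simp only [Prod.mk.injEq] at hi
          rcases hsy with rfl | rfl <;> omega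
        · rw [D, hk1, hi]; simp
      have hl : ∀ l : ℕ, l ≤ Y' → Cl A (a + (-sx - 1) / 2, b + (sy - 1) / 2 - l * sy) := by
        intro l hl
        by_cases h0 : l = 0
        · subst h0; exact ⟨k, by simp [hk]⟩
        apply h2 <;> rcases hsx with rfl | rfl <;> rcases hsy with rfl | rfl <;> omega
      have h := c.wclaim hL hu hw hp (N := Y') (by omega) (by
        intro l h; rw [hk]; simpa [Cl] using hl l h) rfl rfl rfl rfl
      rw [hk, hD] at h
      simp only [ne_eq, not_true, false_and, or_false] at h
      replace h := h.2
      subst er es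
      rcases hsx with rfl | rfl <;> rcases hsy with rfl | rfl <;> simp [cv] at h bw l2 <;>
        ring_nf at h bw l2 <;> omega
    · have e1 : Y = 1 := by omega
      subst e1
      have hc : ∀ x y, x = a + (-sx - 1) / 2 → y = b + (sy - 1) / 2 → Cl A (x, y) := by
        rintro x y rfl rfl; exact ⟨k, hk⟩
      exact c.lconf hL hW (ox := r) (ix := a) (cx := p) (oy := q) (iy := b) (ry := s)
        (vx := a) (wx := r) (vy := b) (wy := q)
        (by unfold Bt; rcases hsx with rfl | rfl <;> omega)
        (by unfold Bt; rcases hsy with rfl | rfl <;> omega)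
        (by
          intro x y g1 g2 g3 g4
          by_cases hx : min a p ≤ x ∧ x < max a p
          · apply h1 <;> omega
          · apply hc <;> rcases hsx with rfl | rfl <;> rcases hsy with rfl | rfl <;> omega)
        (by
          intro x y g1 g2 g3 g4
          by_cases hx : min b s ≤ y ∧ y < max b s
          · apply h2 <;> omega
          · apply hc <;> rcases hsx with rfl | rfl <;> rcases hsy with rfl | rfl <;> omega)
        (Or.inr ⟨rfl, rfl⟩) (Or.inr ⟨rfl, rfl⟩) l1 l2

/-- opposite quadrants, oriented version -/
lemma opp1 {k : ZMod n} {a b sx sy : ℤ} (hsx : sx = 1 ∨ sx = -1) (hsy : sy = 1 ∨ sy = -1)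
    {X Y X' Y' : ℕ} (hX : 1 ≤ X) (hY : 1 ≤ Y) (hX' : 1 ≤ X') (hY' : 1 ≤ Y')
    (hk' : A (k - 1) = (a + (-sx - 1) / 2, b + (-sy - 1) / 2))
    (hk1 : A (k + 1) = (a + (sx - 1) / 2, b + (sy - 1) / 2))
    {p q r s : ℤ} (ep : p = a + sx * X) (eq : q = b + sy * Y) (er : r = a - sx * X')
    (es : s = b - sy * Y')
    (h1 : Bx A a p b q) (h2 : Bx A a r b s)
    (l1 : W (a, q) + W (p, b) < W (a, b) + W (p, q))
    (l2 : W (a, s) + W (r, b) < W (a, b) + W (r, s)) :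
    CG A W (W (a, b) + W (p, q) + W (r, s)) (prs (a, q) (p, b) + Finsupp.single (r, s) 1)
      (prs (a, s) (r, b) + Finsupp.single (p, q) 1) := by
  have i1 := c.isU (k - 1)
  have i2 := c.isU k
  have e1 := A_pred A k
  have e2 := A_succ A k
  rw [hk'] at e1
  rw [hk1] at e2
  have : (D A (k - 1) = (sx, 0) ∧ D A k = (0, sy)) ∨ (D A (k - 1) = (0, sy) ∧ D A k = (sx, 0)) := by
    simp only [IsU, Prod.ext_iff, Prod.fst_sub, Prod.snd_sub, Prod.fst_add, Prod.snd_add] at *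
    rcases hsx with rfl | rfl <;> rcases hsy with rfl | rfl <;> omega
  rcases this with ⟨hu, hw⟩ | ⟨hu, hw⟩
  · refine c.oppH hL hW hsx hsy hX hY hX' hY' hu hw ?_ ep eq er es h1 h2 l1 l2
    rw [hu] at e1
    simp only [Prod.ext_iff, Prod.fst_sub, Prod.snd_sub] at *
    rcases hsx with rfl | rfl <;> rcases hsy with rfl | rfl <;> omega
  · refine c.oppV hL hW hsx hsy hX hY hX' hY' hu hw ?_ ep eq er es h1 h2 l1 l2
    rw [hu] at e1
    simp only [Prod.ext_iff, Prod.fst_sub, Prod.snd_sub] at *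
    rcases hsx with rfl | rfl <;> rcases hsy with rfl | rfl <;> omega

lemma opp {a b p q r s : ℤ} (hx : (a < p ∧ r < a) ∨ (p < a ∧ a < r))
    (hy : (b < q ∧ s < b) ∨ (q < b ∧ b < s))
    (h1 : Bx A a p b q) (h2 : Bx A a r b s)
    (l1 : W (a, q) + W (p, b) < W (a, b) + W (p, q))
    (l2 : W (a, s) + W (r, b) < W (a, b) + W (r, s)) :
    CG A W (W (a, b) + W (p, q) + W (r, s)) (prs (a, q) (p, b) + Finsupp.single (r, s) 1)
      (prs (a, s) (r, b) + Finsupp.single (p, q) 1) := by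
  obtain ⟨sx, hsx, X, X', hX, hX', ep, er⟩ : ∃ sx : ℤ, (sx = 1 ∨ sx = -1) ∧ ∃ X X' : ℕ, 1 ≤ X ∧
      1 ≤ X' ∧ p = a + sx * X ∧ r = a - sx * X' := by
    rcases hx with h | h
    · exact ⟨1, Or.inl rfl, (p - a).toNat, (a - r).toNat, by omega, by omega, by omega, by omega⟩
    · exact ⟨-1, Or.inr rfl, (a - p).toNat, (r - a).toNat, by omega, by omega, by omega, by omega⟩
  obtain ⟨sy, hsy, Y, Y', hY, hY', eq, es⟩ : ∃ sy : ℤ, (sy = 1 ∨ sy = -1) ∧ ∃ X X' : ℕ, 1 ≤ X ∧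
      1 ≤ X' ∧ q = b + sy * X ∧ s = b - sy * X' := by
    rcases hy with h | h
    · exact ⟨1, Or.inl rfl, (q - b).toNat, (b - s).toNat, by omega, by omega, by omega, by omega⟩
    · exact ⟨-1, Or.inr rfl, (b - q).toNat, (s - b).toNat, by omega, by omega, by omega, by omega⟩
  obtain ⟨i1, e1⟩ := h1 (a + (sx - 1) / 2) (b + (sy - 1) / 2)
    (by rcases hsx with rfl | rfl <;> omega) (by rcases hsx with rfl | rfl <;> omega)
    (by rcases hsy with rfl | rfl <;> omega) (by rcases hsy with rfl | rfl <;> omega)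
  obtain ⟨i2, e2⟩ := h2 (a + (-sx - 1) / 2) (b + (-sy - 1) / 2)
    (by rcases hsx with rfl | rfl <;> omega) (by rcases hsx with rfl | rfl <;> omega)
    (by rcases hsy with rfl | rfl <;> omega) (by rcases hsy with rfl | rfl <;> omega)
  have o1 : On (a, b) (A i1) := by
    rw [e1]; unfold On
    rcases hsx with rfl | rfl <;> rcases hsy with rfl | rfl <;> refine ⟨?_, ?_, ?_, ?_⟩ <;>
      simp only <;> omega
  have o2 : On (a, b) (A i2) := by
    rw [e2]; unfold On
    rcases hsx with rfl | rfl <;> rcases hsy with rfl | rfl <;> refine ⟨?_, ?_, ?_, ?_⟩ <;>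
      simp only <;> omega
  have key : i1 = i2 + 2 ∨ i2 = i1 + 2 := by
    have u1 := c.isU i1
    have u2 := c.isU i2
    have hne : i2 ≠ i1 + 1 ∧ i1 ≠ i2 + 1 ∧ i2 ≠ i1 := by
      refine ⟨?_, ?_, ?_⟩
      · rintro rfl
        have := A_succ A i1
        simp only [e1, e2, IsU, Prod.ext_iff, Prod.fst_add, Prod.snd_add] at *
        rcases hsx with rfl | rfl <;> rcases hsy with rfl | rfl <;> omega
      · rintro rfl
        have := A_succ A i2
        simp only [e1, e2, IsU, Prod.ext_iff, Prod.fst_add, Prod.snd_add] at *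
        rcases hsx with rfl | rfl <;> rcases hsy with rfl | rfl <;> omega
      · rintro rfl
        simp only [e1, Prod.ext_iff] at e2
        rcases hsx with rfl | rfl <;> omega
    rcases c.near o1 o2 with h | h | h | h | h
    · left; rw [h]; ring
    · exact absurd (by rw [h]; ring) hne.2.1
    · exact absurd h hne.2.2
    · exact absurd h hne.1
    · exact Or.inr h
  rcases key with h | h
  · refine c.opp1 hL hW (k := i2 + 1) hsx hsy hX hY hX' hY' ?_ ?_ ep eq er es h1 h2 l1 l2
    · rw [add_sub_cancel_right, e2]
    · rw [← e1, h]; congr 1; ring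
  · have := c.opp1 hL hW (k := i1 + 1) (sx := -sx) (sy := -sy) (by omega) (by omega) hX' hY' hX hY
      (by rw [add_sub_cancel_right, e1, neg_neg, neg_neg])
      (by rw [← e2, h]; congr 1; ring) (by rw [er]; ring) (by rw [es]; ring) (by rw [ep]; ring)
      (by rw [eq]; ring) h2 h1 l2 l1
    have := this.symm
    rwa [add_right_comm] at this

end CPath


namespace CPath
variable (c : CPath n A)
  {W : Pt → ℕ} {C L : ℤ} [NeZero n]
  (hL : ∀ i v, On v (A i) → -L ≤ v.1 ∧ v.1 ≤ L ∧ -L ≤ v.2 ∧ v.2 ≤ L)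
  (hW : ∀ i v, On v (A i) → (W v : ℤ) = Wz A L v + C)
include c hL hW

lemma confX {a b p q r s : ℤ} (hr : r = a + 1 ∧ a + 1 < p ∨ r = a - 1 ∧ p < a - 1)
    (hq : q ≠ b) (hs : s ≠ b) (hqs : q ≠ s)
    (h1 : Bx A a p b q) (h2 : Bx A a r b s)
    (l1 : W (a, q) + W (p, b) < W (a, b) + W (p, q))
    (l2 : W (a, s) + W (r, b) < W (a, b) + W (r, s)) :
    CG A W (W (a, b) + W (p, q) + W (r, s)) (prs (a, q) (p, b) + Finsupp.single (r, s) 1)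
      (prs (a, s) (r, b) + Finsupp.single (p, q) 1) := by
  have ht := c.thinBox h1 (by omega) hq.symm
  by_cases hc : (b < q ∧ b < s) ∨ (q < b ∧ s < b)
  · refine c.lconf hL hW (ox := a) (ix := r) (cx := p) (oy := b) (iy := q) (ry := s)
        (vx := a) (wx := r) (vy := b) (wy := q) (by unfold Bt; omega) ?_ h1 h2
        (Or.inl ⟨rfl, rfl⟩) (Or.inl ⟨rfl, rfl⟩) l1 l2
    unfold Bt
    have ht2 : r ≠ a := by omega
    omega
  · refine c.lconf hL hW (ox := a) (ix := r) (cx := p) (oy := q) (iy := b) (ry := s)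
        (vx := a) (wx := r) (vy := b) (wy := q) (by unfold Bt; omega) (by unfold Bt; omega)
        h1.swapy ?_
        (Or.inl ⟨rfl, rfl⟩) (Or.inr ⟨rfl, rfl⟩) l1 l2
    refine Bx.vunion (a := b) (h1.sub ?_ ?_ ?_ ?_) h2 <;> omega

lemma confY {a b p q r s : ℤ} (hr : s = b + 1 ∧ b + 1 < q ∨ s = b - 1 ∧ q < b - 1)
    (hp : (p < a ∧ a < r) ∨ (r < a ∧ a < p))
    (h1 : Bx A a p b q) (h2 : Bx A a r b s)
    (l1 : W (a, q) + W (p, b) < W (a, b) + W (p, q))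
    (l2 : W (a, s) + W (r, b) < W (a, b) + W (r, s)) :
    CG A W (W (a, b) + W (p, q) + W (r, s)) (prs (a, q) (p, b) + Finsupp.single (r, s) 1)
      (prs (a, s) (r, b) + Finsupp.single (p, q) 1) := by
  have ht := c.thinBox h1 (by omega) (by omega)
  have := c.lconf hL hW (ox := p) (ix := a) (cx := r) (oy := b) (iy := s) (ry := q)
        (vx := a) (wx := p) (vy := b) (wy := s) (by unfold Bt; omega) (by unfold Bt; omega)
        (by refine Bx.hunion (a := a) (h1.sub ?_ ?_ ?_ ?_) h2 <;> omega) h1.swapx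
        (Or.inr ⟨rfl, rfl⟩) (Or.inl ⟨rfl, rfl⟩) l2 l1
  have := this.symm
  rwa [add_right_comm] at this

lemma confmain {a b p q r s : ℤ} (hpa : a ≠ p) (hqb : b ≠ q) (hra : a ≠ r) (hsb : b ≠ s)
    (hne : p ≠ r ∨ q ≠ s)
    (h1 : Bx A a p b q) (h2 : Bx A a r b s)
    (l1 : W (a, q) + W (p, b) < W (a, b) + W (p, q))
    (l2 : W (a, s) + W (r, b) < W (a, b) + W (r, s)) :
    CG A W (W (a, b) + W (p, q) + W (r, s)) (prs (a, q) (p, b) + Finsupp.single (r, s) 1)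
      (prs (a, s) (r, b) + Finsupp.single (p, q) 1) := by
  by_cases hqs : q = s
  · subst hqs
    left
    refine ust (x1 := p) (x2 := r) (y1 := b) (y2 := q) (h1.hunion h2) (by omega) hqb
      (Finsupp.single (a, q) 1) ?_ ?_ <;> simp only [prs] <;> abel
  by_cases hpr : p = r
  · subst hpr
    left
    refine ust (x1 := a) (x2 := p) (y1 := q) (y2 := s) (h1.vunion h2) hpa hqs
      (Finsupp.single (p, b) 1) ?_ ?_ <;> simp only [prs] <;> abel
  have t1 := c.thinBox h1 hpa hqb
  have t2 := c.thinBox h2 hra hsb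
  by_cases hx : (a < p ∧ a < r) ∨ (p < a ∧ r < a)
  · by_cases c1 : r = a + 1 ∨ r = a - 1
    · exact c.confX hL hW (by omega) hqb.symm hsb.symm hqs h1 h2 l1 l2
    by_cases c2 : p = a + 1 ∨ p = a - 1
    · have := (c.confX hL hW (by omega) hsb.symm hqb.symm (Ne.symm hqs) h2 h1 l2 l1).symm
      rwa [add_right_comm] at this
    exfalso
    have hu : Bx A a (if a < p then a + 2 else a - 2) q s := by
      refine Bx.vunion (a := b) (h1.sub ?_ ?_ ?_ ?_) (h2.sub ?_ ?_ ?_ ?_) <;> (try split_ifs) <;> omega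
    have := c.thinBox hu (by split_ifs <;> omega) (by omega)
    split_ifs at this <;> omega
  · by_cases hy : (b < q ∧ b < s) ∨ (q < b ∧ s < b)
    · by_cases c1 : s = b + 1 ∨ s = b - 1
      · exact c.confY hL hW (by omega) (by omega) h1 h2 l1 l2
      by_cases c2 : q = b + 1 ∨ q = b - 1
      · have := (c.confY hL hW (by omega) (by omega) h2 h1 l2 l1).symm
        rwa [add_right_comm] at this
      exfalso
      have hu : Bx A p r b (if b < q then b + 2 else b - 2) := by
        refine Bx.hunion (a := a) (h1.sub ?_ ?_ ?_ ?_) (h2.sub ?_ ?_ ?_ ?_) <;> (try split_ifs) <;> omega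
      have := c.thinBox hu (by omega) (by split_ifs <;> omega)
      split_ifs at this <;> omega
    · exact c.opp hL hW (by omega) (by omega) h1 h2 l1 l2

lemma strict {x1 x2 y1 y2 : ℤ} (h : Bx A x1 x2 y1 y2) (h1 : x1 ≠ x2) (h2 : y1 ≠ y2) :
    W (x1, y1) + W (x2, y2) ≠ W (x1, y2) + W (x2, y1) := by
  intro he
  have b := c.hW4 hW h h1 h2
  have t := c.thinBox h h1 h2
  obtain ⟨i, hi⟩ := h.on h1 h2
  obtain ⟨j, hj⟩ := h.swapx.swapy.on h1.symm h2.symm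
  have hi := hL _ _ hi
  have hj := hL _ _ hj
  simp only at hi hj
  have e : Wz A L (x1, y1) + Wz A L (x2, y2) = Wz A L (x1, y2) + Wz A L (x2, y1) := by omega
  unfold Wz at e
  simp only at e
  have e2 : ∃ m : ℤ, (x1 - x2) * (y1 - y2) = (2 * L + 1) * m := by
    refine ⟨mu A (L + 1) (4 * L + 4) (x1, y2) + mu A (L + 1) (4 * L + 4) (x2, y1) -
      mu A (L + 1) (4 * L + 4) (x1, y1) - mu A (L + 1) (4 * L + 4) (x2, y2), ?_⟩
    linear_combination e
  obtain ⟨m, hm⟩ := e2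
  have hb : ∃ z : ℤ, z = (2 * L + 1) * m ∧ z ≠ 0 ∧ -(2 * L + 1) < z ∧ z < 2 * L + 1 := by
    refine ⟨_, hm, mul_ne_zero (by omega) (by omega), ?_⟩
    rcases t with (rfl | rfl) | (rfl | rfl)
    · have : (x1 - (x1 + 1)) * (y1 - y2) = y2 - y1 := by ring
      rw [this]; omega
    · have : (x1 - (x1 - 1)) * (y1 - y2) = y1 - y2 := by ring
      rw [this]; omega
    · have : (x1 - x2) * (y1 - (y1 + 1)) = x2 - x1 := by ring
      rw [this]; omega
    · have : (x1 - x2) * (y1 - (y1 - 1)) = x1 - x2 := by ring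
      rw [this]; omega
  obtain ⟨z, hz, z0, z1, z2⟩ := hb
  rcases lt_trichotomy m 0 with h | h | h
  · nlinarith
  · subst h; simp at hz; exact z0 hz
  · nlinarith

lemma good : GoodSys (mv A) W where
  swap := by
    rintro x y z t ⟨h1, h2, h3, h4⟩
    exact ⟨h1.symm, h2.symm, h3.swapx.swapy, by tauto⟩
  symm := mv_symm
  ne := by
    rintro x y z t ⟨h1, h2, h3, h4⟩ rfl
    exact h1 rfl
  strict := by
    rintro x y z t ⟨h1, h2, h3, ⟨rfl, rfl⟩ | ⟨rfl, rfl⟩⟩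
    · exact c.strict hL hW h3 h1 h2
    · rw [add_comm (W (y.1, x.2))]; exact c.strict hL hW h3 h1 h2
  uniq := by
    rintro x y z t z' t' ⟨-, -, -, ⟨rfl, rfl⟩ | ⟨rfl, rfl⟩⟩ ⟨-, -, -, ⟨rfl, rfl⟩ | ⟨rfl, rfl⟩⟩
    · rfl
    · exact prs_comm _ _
    · exact prs_comm _ _
    · rfl
  conf := by
    rintro v y z t y' z' t' ⟨h1, h2, h3, h4⟩ ⟨h1', h2', h3', h4'⟩ hne l l'
    obtain ⟨a, b⟩ := v
    obtain ⟨p, q⟩ := y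
    obtain ⟨r, s⟩ := y'
    simp only at *
    have hne' : p ≠ r ∨ q ≠ s := by
      by_contra hh
      push Not at hh
      exact hne (by rw [hh.1, hh.2])
    have e : prs z t = prs (a, q) (p, b) ∧ W z + W t = W (a, q) + W (p, b) := by
      rcases h4 with ⟨rfl, rfl⟩ | ⟨rfl, rfl⟩
      · exact ⟨rfl, rfl⟩
      · exact ⟨prs_comm _ _, add_comm _ _⟩
    have e' : prs z' t' = prs (a, s) (r, b) ∧ W z' + W t' = W (a, s) + W (r, b) := by
      rcases h4' with ⟨rfl, rfl⟩ | ⟨rfl, rfl⟩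
      · exact ⟨rfl, rfl⟩
      · exact ⟨prs_comm _ _, add_comm _ _⟩
    rw [e.1, e'.1]
    rw [e.2] at l
    rw [e'.2] at l'
    exact c.confmain hL hW h1 h2 h1' h2' hne' h3 h3' l l'

omit hL hW in
lemma exists_good : ∃ W : Pt → ℕ, GoodSys (mv A) W := by
  classical
  obtain ⟨L, hL⟩ : ∃ L : ℤ, ∀ i v, On v (A i) → -L ≤ v.1 ∧ v.1 ≤ L ∧ -L ≤ v.2 ∧ v.2 ≤ L := by
    refine ⟨∑ i, (|(A i).1| + |(A i).2| + 1), ?_⟩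
    intro i v hv
    have := Finset.single_le_sum (f := fun i => |(A i).1| + |(A i).2| + 1) (s := Finset.univ)
      (fun i _ => by positivity) (Finset.mem_univ i)
    try simp only at this
    obtain ⟨h1, h2, h3, h4⟩ := hv
    have a1 := neg_abs_le (A i).1
    have a2 := le_abs_self (A i).1
    have a3 := neg_abs_le (A i).2
    have a4 := le_abs_self (A i).2
    have a5 := abs_nonneg (A i).1
    have a6 := abs_nonneg (A i).2
    refine ⟨?_, ?_, ?_, ?_⟩ <;> linarith
  let C : ℤ := ∑ v ∈ Finset.Icc (-L) L ×ˢ Finset.Icc (-L) L, |Wz A L v|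
  refine ⟨fun v => (Wz A L v + C).toNat, c.good hL (C := C) ?_⟩
  intro i v hv
  have h := hL i v hv
  have := Finset.single_le_sum (f := fun v => |Wz A L v|) (s := Finset.Icc (-L) L ×ˢ Finset.Icc (-L) L)
      (fun i _ => abs_nonneg _) (a := v) (by simp; omega)
  have h2 := neg_abs_le (Wz A L v)
  rw [Int.toNat_of_nonneg]
  try simp only at this
  linarith

end CPath
end Path


lemma polyo_eq_sys {n : ℕ} {A : ZMod n → Pt} (K : Type*) [Field K] (P : Finset Pt)
    (hP : ∀ c, c ∈ P ↔ ∃ i, A i = c) : polyoIdeal K P = sysIdeal K (mv A) := by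
  have key : ∀ x1 x2 y1 y2 : ℤ, x1 < x2 → y1 < y2 →
      Bx A x1 x2 y1 y2 →
      (X (x1, y1) * X (x2, y2) - X (x1, y2) * X (x2, y1) : MvPolynomial Pt K)
        ∈ polyoIdeal K P := by
    intro x1 x2 y1 y2 h1 h2 hb
    apply Ideal.subset_span
    refine ⟨(x1, y1), (x2, y2), ⟨h1, h2, ?_⟩, rfl⟩
    rintro ⟨p, q⟩ a1 a2 a3 a4
    simp only at a1 a2 a3 a4
    exact (hP _).2 (hb p q (by omega) (by omega) (by omega) (by omega))
  apply le_antisymm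
  · apply Ideal.span_le.2
    rintro f ⟨a, b, ⟨h1, h2, h3⟩, rfl⟩
    apply Ideal.subset_span
    refine ⟨a, b, (a.1, b.2), (b.1, a.2), ⟨by omega, by omega, ?_, Or.inl ⟨rfl, rfl⟩⟩, rfl⟩
    intro p q a1 a2 a3 a4
    exact (hP _).1 (h3 (p, q) (by simp only; omega) (by simp only; omega)
      (by simp only; omega) (by simp only; omega))
  · apply Ideal.span_le.2
    rintro f ⟨x, y, z, t, ⟨h1, h2, h3, h4⟩, rfl⟩
    obtain ⟨x1, x2⟩ := x
    obtain ⟨y1, y2⟩ := y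
    simp only at h1 h2 h3 h4
    have e : (X z * X t : MvPolynomial Pt K) = X (x1, y2) * X (y1, x2) := by
      rcases h4 with ⟨rfl, rfl⟩ | ⟨rfl, rfl⟩
      · rfl
      · ring
    rw [e, SetLike.mem_coe]
    have hb : ∀ a b c d : ℤ, min a b = min x1 y1 → max a b = max x1 y1 →
        min c d = min x2 y2 → max c d = max x2 y2 → Bx A a b c d := by
      intro a b c d e1 e2 e3 e4 p q a1 a2 a3 a4
      exact h3 p q (by omega) (by omega) (by omega) (by omega)
    rcases lt_or_gt_of_ne h1 with l1 | l1 <;> rcases lt_or_gt_of_ne h2 with l2 | l2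
    · exact key _ _ _ _ l1 l2 h3
    · have := key x1 y1 y2 x2 l1 l2 (hb _ _ _ _ rfl rfl (min_comm _ _) (max_comm _ _))
      have := neg_mem this
      convert this using 1
      ring
    · have := key y1 x1 x2 y2 l1 l2 (hb _ _ _ _ (min_comm _ _) (max_comm _ _) rfl rfl)
      have := neg_mem this
      convert this using 1
      ring
    · have := key y1 x1 y2 x2 l1 l2
        (hb _ _ _ _ (min_comm _ _) (max_comm _ _) (min_comm _ _) (max_comm _ _))
      convert this using 1
      ring

theorem polyoIdeal_isRadical_of_closedPath
    (K : Type*) [Field K] (P : Finset Pt) (hP : IsClosedPath P) :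
    (polyoIdeal K P).IsRadical := by
  obtain ⟨n, hn, A, inj, adj, disj, hA⟩ := hP
  haveI : NeZero n := ⟨by omega⟩
  have c : CPath n A := ⟨hn, inj, adj, disj⟩
  obtain ⟨W, g⟩ := c.exists_good
  rw [polyo_eq_sys K P hA]
  exact sys_radical K g

end ClosedPathPaper
end

section
/- There exists a closed path polyomino P (in particular, a non-simple polyomino) and a primitive binomial f ∈ I_P such that f is not squarefree, i.e., at least one of the two monomials of f is divisible by the square of a variable. Consequently, the universal Gröbner basis of I_P (the union of the reduced Gröbner bases over all monomial orders, which for the toric ideal I_P coincides with the set of primitive binomials of I_P) is not squarefree. -/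
namespace ClosedPathPaper

open MvPolynomial

/-- The binomial `X^{m₁} - X^{m₂}` is a primitive binomial of the ideal `I`. -/
def IsPrimitiveBinomial {K : Type*} [Field K] (I : Ideal (MvPolynomial Pt K))
    (m₁ m₂ : Pt →₀ ℕ) : Prop :=
  m₁ ≠ m₂ ∧
  (MvPolynomial.monomial m₁ (1 : K) - MvPolynomial.monomial m₂ (1 : K)) ∈ I ∧
  ∀ n₁ n₂ : Pt →₀ ℕ, n₁ ≠ n₂ →
    (MvPolynomial.monomial n₁ (1 : K) - MvPolynomial.monomial n₂ (1 : K)) ∈ I →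
    n₁ ≤ m₁ → n₂ ≤ m₂ → n₁ = m₁ ∧ n₂ = m₂

def ringP : Finset Pt := {(0,0),(1,0),(2,0),(2,1),(2,2),(1,2),(0,2),(0,1)}

def ringA : ZMod 8 → Pt := fun i => (![(0,0),(1,0),(2,0),(2,1),(2,2),(1,2),(0,2),(0,1)] : Fin 8 → Pt) i

theorem mem_ringP (c : Pt) : c ∈ ringP ↔
    (0 ≤ c.1 ∧ c.1 ≤ 2 ∧ 0 ≤ c.2 ∧ c.2 ≤ 2 ∧ ¬ (c.1 = 1 ∧ c.2 = 1)) := by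
  obtain ⟨x, y⟩ := c
  simp only [ringP, Finset.mem_insert, Finset.mem_singleton, Prod.mk.injEq]
  omega

theorem cellVerts_disj (a b : Pt)
    (h : a.1 + 1 < b.1 ∨ b.1 + 1 < a.1 ∨ a.2 + 1 < b.2 ∨ b.2 + 1 < a.2) :
    cellVerts a ∩ cellVerts b = ∅ := by
  ext ⟨x, y⟩
  obtain ⟨a1, a2⟩ := a
  obtain ⟨b1, b2⟩ := b
  simp only [cellVerts, Set.mem_inter_iff, Set.mem_insert_iff, Set.mem_singleton_iff,
    Prod.mk.injEq, Set.mem_empty_iff_false, iff_false] at *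
  omega

theorem ringP_closed : IsClosedPath ringP := by
  refine ⟨8, by norm_num, ringA, ?_, ?_, ?_, ?_⟩
  · have : ∀ i j : ZMod 8, ringA i = ringA j → i = j := by decide
    exact this
  · have : ∀ i : ZMod 8, ringA (i+1) = ((ringA i).1 + 1, (ringA i).2) ∨
      ringA (i+1) = ((ringA i).1 - 1, (ringA i).2) ∨
      ringA (i+1) = ((ringA i).1, (ringA i).2 + 1) ∨
      ringA (i+1) = ((ringA i).1, (ringA i).2 - 1) := by decide
    exact this
  · intro i j h1 h2 h3 h4 h5
    apply cellVerts_disj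
    have : ∀ i j : ZMod 8, j ≠ i - 2 → j ≠ i - 1 → j ≠ i → j ≠ i + 1 → j ≠ i + 2 →
      ((ringA i).1 + 1 < (ringA j).1 ∨ (ringA j).1 + 1 < (ringA i).1 ∨
      (ringA i).2 + 1 < (ringA j).2 ∨ (ringA j).2 + 1 < (ringA i).2) := by decide
    exact this i j h1 h2 h3 h4 h5
  · intro c
    have h : ringP = Finset.univ.image (fun i : ZMod 8 => ringA i) := by decide
    rw [h]
    simp only [Finset.mem_image, Finset.mem_univ, true_and]

noncomputable def wt (w : Pt → ℕ) (n : Pt →₀ ℕ) : ℕ := n.sum fun p k => w p * k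

theorem wt_eq (K : Type*) [Field K] (w : Pt → ℕ)
    (hw : ∀ a b : Pt, IsInnerInterval ringP a b → w a + w b = w (a.1, b.2) + w (b.1, a.2))
    (n₁ n₂ : Pt →₀ ℕ)
    (h : (monomial n₁ (1 : K) - monomial n₂ (1 : K)) ∈ polyoIdeal K ringP) :
    wt w n₁ = wt w n₂ := by
  let φ : MvPolynomial Pt K →+* Polynomial K :=
    (aeval (fun p => (Polynomial.X : Polynomial K) ^ w p)).toRingHom
  have hle : polyoIdeal K ringP ≤ RingHom.ker φ := by
    refine Ideal.span_le.2 ?_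
    rintro f ⟨a, b, hab, rfl⟩
    simp only [SetLike.mem_coe, RingHom.mem_ker, innerMinor, φ, AlgHom.toRingHom_eq_coe,
      RingHom.coe_coe, map_sub, map_mul, aeval_X, ← pow_add, hw a b hab, sub_self]
  have hmon : ∀ n : Pt →₀ ℕ, φ (monomial n (1 : K)) = Polynomial.X ^ (wt w n) := by
    intro n
    simp only [φ, AlgHom.toRingHom_eq_coe, RingHom.coe_coe, aeval_monomial, map_one, one_mul,
      ← pow_mul, wt, Finsupp.sum, Finsupp.prod, Finset.prod_pow_eq_pow_sum]
  have h0 := hle h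
  rw [RingHom.mem_ker, map_sub, hmon, hmon, sub_eq_zero] at h0
  have := congrArg Polynomial.natDegree h0
  simpa using this

noncomputable def M1 : Pt →₀ ℕ :=
  Finsupp.single (0,0) 1 + Finsupp.single (0,2) 1 + Finsupp.single (1,3) 1 +
  Finsupp.single (2,1) 1 + Finsupp.single (3,3) 1

noncomputable def M2 : Pt →₀ ℕ :=
  Finsupp.single (0,3) 2 + Finsupp.single (1,1) 1 + Finsupp.single (2,2) 1 +
  Finsupp.single (3,0) 1

def S1 : Finset Pt := {(0,0),(0,2),(1,3),(2,1),(3,3)}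
def S2 : Finset Pt := {(0,3),(1,1),(2,2),(3,0)}

theorem M1_supp (n : Pt →₀ ℕ) (h : n ≤ M1) (p : Pt) (hp : p ∉ S1) : n p = 0 := by
  have := h p
  simp only [S1, Finset.mem_insert, Finset.mem_singleton, not_or] at hp
  obtain ⟨h1, h2, h3, h4, h5⟩ := hp
  simpa [M1, Finsupp.single_apply, Ne.symm h1, Ne.symm h2, Ne.symm h3, Ne.symm h4,
    Ne.symm h5] using this

theorem M2_supp (n : Pt →₀ ℕ) (h : n ≤ M2) (p : Pt) (hp : p ∉ S2) : n p = 0 := by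
  have := h p
  simp only [S2, Finset.mem_insert, Finset.mem_singleton, not_or] at hp
  obtain ⟨h1, h2, h3, h4⟩ := hp
  simpa [M2, Finsupp.single_apply, Ne.symm h1, Ne.symm h2, Ne.symm h3, Ne.symm h4] using this

theorem wt_M1 (w : Pt → ℕ) (n : Pt →₀ ℕ) (h : n ≤ M1) : wt w n =
    w (0,0) * n (0,0) + (w (0,2) * n (0,2) + (w (1,3) * n (1,3) + (w (2,1) * n (2,1) +
      w (3,3) * n (3,3)))) := by
  rw [wt, Finsupp.sum_of_support_subset (s := S1)]
  · simp [S1]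
  · intro p hp
    by_contra hc
    exact (Finsupp.mem_support_iff.1 hp) (M1_supp n h p hc)
  · simp

theorem wt_M2 (w : Pt → ℕ) (n : Pt →₀ ℕ) (h : n ≤ M2) : wt w n =
    w (0,3) * n (0,3) + (w (1,1) * n (1,1) + (w (2,2) * n (2,2) + w (3,0) * n (3,0))) := by
  rw [wt, Finsupp.sum_of_support_subset (s := S2)]
  · simp [S2]
  · intro p hp
    by_contra hc
    exact (Finsupp.mem_support_iff.1 hp) (M2_supp n h p hc)
  · simp

theorem minor_mem (K : Type*) [Field K] (a b : Pt)
    (h : IsInnerInterval ringP a b) : innerMinor K a b ∈ polyoIdeal K ringP :=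
  Ideal.subset_span ⟨a, b, h, rfl⟩

theorem M_mem (K : Type*) [Field K] :
    (monomial M1 (1 : K) - monomial M2 (1 : K)) ∈ polyoIdeal K ringP := by
  have e1 : monomial M1 (1 : K) = X (0,0) * X (0,2) * X (1,3) * X (2,1) * X (3,3) := by
    simp only [M1, X, monomial_mul, mul_one]
  have e2 : monomial M2 (1 : K) = X (0,3) * X (0,3) * X (1,1) * X (2,2) * X (3,0) := by
    simp only [M2, X, monomial_mul, mul_one, ← Finsupp.single_add]
  have inner : ∀ a b : Pt, a.1 < b.1 → a.2 < b.2 → 0 ≤ a.1 → b.1 ≤ 3 → 0 ≤ a.2 → b.2 ≤ 3 →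
      ¬ (a.1 ≤ 1 ∧ 1 < b.1 ∧ a.2 ≤ 1 ∧ 1 < b.2) → innerMinor K a b ∈ polyoIdeal K ringP := by
    intro a b h1 h2 h3 h4 h5 h6 h7
    refine minor_mem K a b ⟨h1, h2, fun c => ?_⟩
    rw [mem_ringP]
    omega
  have i1 := inner (0,0) (1,3) (by norm_num) (by norm_num) (by norm_num) (by norm_num)
    (by norm_num) (by norm_num) (by norm_num)
  have i2 := inner (2,1) (3,3) (by norm_num) (by norm_num) (by norm_num) (by norm_num)
    (by norm_num) (by norm_num) (by norm_num)
  have i3 := inner (1,0) (3,1) (by norm_num) (by norm_num) (by norm_num) (by norm_num)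
    (by norm_num) (by norm_num) (by norm_num)
  have i4 := inner (0,2) (2,3) (by norm_num) (by norm_num) (by norm_num) (by norm_num)
    (by norm_num) (by norm_num) (by norm_num)
  have key : (monomial M1 (1 : K) - monomial M2 (1 : K)) =
      X (0,2) * X (2,1) * X (3,3) * innerMinor K (0,0) (1,3) +
      X (0,3) * X (1,0) * X (0,2) * innerMinor K (2,1) (3,3) +
      X (0,3) * X (0,2) * X (2,3) * innerMinor K (1,0) (3,1) +
      X (0,3) * X (1,1) * X (3,0) * innerMinor K (0,2) (2,3) := by
    rw [e1, e2]
    simp only [innerMinor]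
    ring
  rw [key]
  exact add_mem (add_mem (add_mem (Ideal.mul_mem_left _ _ i1) (Ideal.mul_mem_left _ _ i2))
    (Ideal.mul_mem_left _ _ i3)) (Ideal.mul_mem_left _ _ i4)

theorem M_prim (K : Type*) [Field K] : IsPrimitiveBinomial (polyoIdeal K ringP) M1 M2 := by
  refine ⟨?_, M_mem K, ?_⟩
  · intro h
    have := DFunLike.congr_fun h (0,0)
    simp [M1, M2, Finsupp.single_apply] at this
  intro n₁ n₂ hne hmem h1 h2
  have row : ∀ i : ℤ, wt (fun p => if p.1 = i then 1 else 0) n₁ =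
      wt (fun p => if p.1 = i then 1 else 0) n₂ := fun i =>
    wt_eq K _ (fun a b _ => rfl) n₁ n₂ hmem
  have col : ∀ i : ℤ, wt (fun p => if p.2 = i then 1 else 0) n₁ =
      wt (fun p => if p.2 = i then 1 else 0) n₂ := fun i =>
    wt_eq K _ (fun a b _ => add_comm _ _) n₁ n₂ hmem
  have blk : wt (fun p => if p.1 ≤ 1 ∧ p.2 ≤ 1 then 1 else 0) n₁ =
      wt (fun p => if p.1 ≤ 1 ∧ p.2 ≤ 1 then 1 else 0) n₂ := by
    refine wt_eq K _ (fun a b h => ?_) n₁ n₂ hmem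
    obtain ⟨g1, g2, g3⟩ := h
    have g4 := g3 (1,1)
    have g5 : ((1,1) : Pt) ∉ ringP := by decide
    dsimp only at g4 ⊢
    have : ¬ (a.1 ≤ 1 ∧ 1 < b.1 ∧ a.2 ≤ 1 ∧ 1 < b.2) := fun hh =>
      g5 (g4 hh.1 hh.2.1 hh.2.2.1 hh.2.2.2)
    split_ifs <;> omega
  have r0 := row 0
  have r1 := row 1
  have r2 := row 2
  have r3 := row 3
  have c0 := col 0
  have c1 := col 1
  have c2 := col 2
  have c3 := col 3
  rw [wt_M1 _ _ h1, wt_M2 _ _ h2] at r0 r1 r2 r3 c0 c1 c2 c3 blk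
  norm_num at r0 r1 r2 r3 c0 c1 c2 c3 blk
  have b1 : n₁ (0,0) ≤ 1 := by simpa [M1, Finsupp.single_apply] using h1 (0,0)
  have ht : n₁ (0,0) = 0 ∨ n₁ (0,0) = 1 := by omega
  rcases ht with ht | ht
  · exfalso
    apply hne
    have z1 : n₁ = 0 := by
      ext p
      by_cases hp : p ∈ S1
      · simp only [S1, Finset.mem_insert, Finset.mem_singleton] at hp
        rcases hp with rfl | rfl | rfl | rfl | rfl <;> simp only [Finsupp.coe_zero, Pi.zero_apply] <;> omega
      · exact M1_supp _ h1 p hp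
    have z2 : n₂ = 0 := by
      ext p
      by_cases hp : p ∈ S2
      · simp only [S2, Finset.mem_insert, Finset.mem_singleton] at hp
        rcases hp with rfl | rfl | rfl | rfl <;> simp only [Finsupp.coe_zero, Pi.zero_apply] <;> omega
      · exact M2_supp _ h2 p hp
    rw [z1, z2]
  · constructor
    · ext p
      by_cases hp : p ∈ S1
      · simp only [S1, Finset.mem_insert, Finset.mem_singleton] at hp
        rcases hp with rfl | rfl | rfl | rfl | rfl <;> simp [M1, Finsupp.single_apply] <;> omega
      · rw [M1_supp _ h1 p hp, M1_supp _ le_rfl p hp]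
    · ext p
      by_cases hp : p ∈ S2
      · simp only [S2, Finset.mem_insert, Finset.mem_singleton] at hp
        rcases hp with rfl | rfl | rfl | rfl <;> simp [M2, Finsupp.single_apply] <;> omega
      · rw [M2_supp _ h2 p hp, M2_supp _ le_rfl p hp]

theorem exists_closedPath_with_nonSquarefree_primitive_binomial
    (K : Type*) [Field K] :
    ∃ P : Finset Pt, IsClosedPath P ∧
      (∃ m₁ m₂ : Pt →₀ ℕ, IsPrimitiveBinomial (polyoIdeal K P) m₁ m₂ ∧
        ((∃ w, 2 ≤ m₁ w) ∨ (∃ w, 2 ≤ m₂ w))) ∧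
      ¬ (∀ m₁ m₂ : Pt →₀ ℕ, IsPrimitiveBinomial (polyoIdeal K P) m₁ m₂ →
          (∀ w, m₁ w ≤ 1) ∧ (∀ w, m₂ w ≤ 1)) := by
  have h2 : 2 ≤ M2 (0,3) := by simp [M2, Finsupp.single_apply]
  refine ⟨ringP, ringP_closed, ⟨M1, M2, M_prim K, Or.inr ⟨(0,3), h2⟩⟩, fun h => ?_⟩
  have := (h M1 M2 (M_prim K)).2 (0,3)
  omega


end ClosedPathPaper
end
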